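/- arXiv:2309.02806 — 4 statements merged into one kernel-verified Lean document; each statement's English description precedes it below -/
import Mathlib

section
/- Let (X,d_X) be a compact metric space, λ a positive Radon measure on X with λ(X) > 0, c ∈ C(X×X,ℝ), 0 < m ≤ λ(X)/2 and f ∈ L^1_m. Then there is no duality gap: Υ*(f) = Υ(f). -/
open MeasureTheory ENNReal Filter Set

noncomputable section

/-- The set `Π_f` of admissible exterior transport plans in a measured space `(X, λ)`:
first marginal `f · λ`, second marginal `≤ (1 - f) · λ`. -/
def PlansC {X : Type*} [MeasurableSpace X] (lam : Measure X) (f : X → ℝ) :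
    Set (Measure (X × X)) :=
  {γ | γ.map Prod.fst = lam.withDensity (fun x => ENNReal.ofReal (f x)) ∧
       γ.map Prod.snd ≤ lam.withDensity (fun x => ENNReal.ofReal (1 - f x))}

/-- The primal functional `Υ(f) = inf { ∫ c dγ : γ ∈ Π_f }`. -/
def UpsC {X : Type*} [MeasurableSpace X] (c : X × X → ℝ) (lam : Measure X) (f : X → ℝ) : ℝ :=
  sInf ((fun γ : Measure (X × X) => ∫ p, c p ∂γ) '' PlansC lam f)

/-- `f ∈ L¹_m`: measurable, `0 ≤ f ≤ 1` and `∫ f dλ ≤ m`. -/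
def MemL1mC {X : Type*} [MeasurableSpace X] (lam : Measure X) (m : ℝ) (f : X → ℝ) : Prop :=
  Measurable f ∧ (∀ x, 0 ≤ f x ∧ f x ≤ 1) ∧ (∫ x, f x ∂lam) ≤ m

/-- The `c`-transform `ξ^c (y) = inf_x (c(x,y) - ξ(x))`. -/
def ctr {X : Type*} (c : X × X → ℝ) (ξ : X → ℝ) : X → ℝ := fun y => ⨅ x, (c (x, y) - ξ x)

/-- The `c̄`-transform `ζ^{c̄} (x) = inf_y (c(x,y) - ζ(y))`. -/
def cbtr {X : Type*} (c : X × X → ℝ) (ζ : X → ℝ) : X → ℝ := fun x => ⨅ y, (c (x, y) - ζ y)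

/-- The negative part `ψ_- = min(ψ, 0)`. -/
def negp {X : Type*} (ψ : X → ℝ) : X → ℝ := fun x => min (ψ x) 0

/-- The set `Φ' = { φ ∈ C(X) : φ = ((φ^c)_-)^{c̄}, max φ^c ≥ 0 }`. -/
def PhiP {X : Type*} [TopologicalSpace X] (c : X × X → ℝ) : Set C(X, ℝ) :=
  {φ | ⇑φ = cbtr c (negp (ctr c ⇑φ)) ∧ ∃ y, 0 ≤ ctr c ⇑φ y}

/-- The dual functional `K_f(φ, ψ) = ∫ (f φ + (1 - f) ψ) dλ`. -/
def Kfun {X : Type*} [MeasurableSpace X] (lam : Measure X) (f φ ψ : X → ℝ) : ℝ :=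
  ∫ x, (f x * φ x + (1 - f x) * ψ x) ∂lam

/-- The dual problem `Υ*(f)`: supremum of `K_f(φ,ψ)` over continuous pairs with `ψ ≤ 0` and
`φ ⊕ ψ ≤ c`. -/
def UpsStarC {X : Type*} [MeasurableSpace X] [TopologicalSpace X] (c : X × X → ℝ)
    (lam : Measure X) (f : X → ℝ) : ℝ :=
  sSup ((fun p : (X → ℝ) × (X → ℝ) => Kfun lam f p.1 p.2) ''
    {p | Continuous p.1 ∧ Continuous p.2 ∧ (∀ y, p.2 y ≤ 0) ∧
      ∀ x y, p.1 x + p.2 y ≤ c (x, y)})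

open scoped CompactlySupported Pointwise

/-- A sublinear functional on a real vector space dominates a linear functional that agrees with it
at a prescribed point. -/
theorem exists_linear_eq_of_sublinear {E : Type*} [AddCommGroup E] [Module ℝ E] (N : E → ℝ)
    (N_hom : ∀ t : ℝ, 0 < t → ∀ x, N (t • x) = t * N x)
    (N_add : ∀ x y, N (x + y) ≤ N x + N y) (x₀ : E) :
    ∃ g : E →ₗ[ℝ] ℝ, g x₀ = N x₀ ∧ ∀ x, g x ≤ N x := by
  have N_zero : N 0 = 0 := by
    have h := N_hom 2 (by norm_num) 0
    rw [smul_zero] at h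
    linarith
  have H : ∀ t : ℝ, t • x₀ = 0 → (RingHom.id ℝ) t • N x₀ = 0 := by
    intro t ht
    rcases smul_eq_zero.1 ht with rfl | rfl
    · simp
    · simp [N_zero]
  obtain ⟨g, hg, hgN⟩ := exists_extension_of_le_sublinear
    (LinearPMap.mkSpanSingleton' x₀ (N x₀) H) N N_hom N_add (by
      rintro ⟨x, hx⟩
      obtain ⟨t, rfl⟩ := Submodule.mem_span_singleton.1 hx
      rw [LinearPMap.mkSpanSingleton'_apply]
      simp only [RingHom.id_apply, smul_eq_mul]
      rcases lt_trichotomy t 0 with ht | rfl | ht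
      · have h₁ : N (t • x₀) = -t * N (-x₀) := by
          rw [← N_hom (-t) (by linarith)]
          simp
        have h₂ := N_add x₀ (-x₀)
        rw [add_neg_cancel, N_zero] at h₂
        rw [h₁]
        nlinarith
      · simp [N_zero]
      · rw [N_hom t ht])
  refine ⟨g, ?_, hgN⟩
  have hx₀ : x₀ ∈ (LinearPMap.mkSpanSingleton' x₀ (N x₀) H).domain :=
    Submodule.mem_span_singleton_self x₀
  have h := hg ⟨x₀, hx₀⟩
  rwa [LinearPMap.mkSpanSingleton'_apply_self] at h

theorem ContinuousMap.integrable_of_compactSpace {Y : Type*} [TopologicalSpace Y] [CompactSpace Y]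
    [MeasurableSpace Y] [BorelSpace Y] (μ : Measure Y) [IsFiniteMeasure μ] (u : C(Y, ℝ)) :
    Integrable u μ :=
  u.continuous.integrable_of_hasCompactSupport (HasCompactSupport.of_compactSpace u)

/-- Riesz–Markov–Kakutani on a compact space, for functionals on all continuous functions. -/
theorem exists_finite_measure_of_nonneg_linear {Y : Type*} [TopologicalSpace Y] [T2Space Y]
    [CompactSpace Y] [MeasurableSpace Y] [BorelSpace Y] (L : C(Y, ℝ) →ₗ[ℝ] ℝ)
    (hL : ∀ u, 0 ≤ u → 0 ≤ L u) :
    ∃ γ : Measure Y, IsFiniteMeasure γ ∧ ∀ u : C(Y, ℝ), ∫ y, u y ∂γ = L u := by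
  let Λ : C_c(Y, ℝ) →ₚ[ℝ] ℝ := PositiveLinearMap.mk₀
    { toFun := fun u => L (u : C(Y, ℝ))
      map_add' := fun u v => L.map_add (u : C(Y, ℝ)) (v : C(Y, ℝ))
      map_smul' := fun t u => L.map_smul t (u : C(Y, ℝ)) }
    (fun u hu => hL _ hu)
  refine ⟨RealRMK.rieszMeasure Λ, inferInstance, fun u => ?_⟩
  exact RealRMK.integral_rieszMeasure Λ ⟨u, HasCompactSupport.of_compactSpace u⟩

/-- Finite measures on a metric space are ordered as their integrals of nonnegative continuous
functions are. -/
theorem measure_le_of_forall_integral_le {Y : Type*} [PseudoMetricSpace Y]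
    [MeasurableSpace Y] [BorelSpace Y] {μ ν : Measure Y} [IsFiniteMeasure μ] [IsFiniteMeasure ν]
    (h : ∀ ψ : C(Y, ℝ), 0 ≤ ψ → ∫ y, ψ y ∂μ ≤ ∫ y, ψ y ∂ν) : μ ≤ ν := by
  have hclosed : ∀ F : Set Y, IsClosed F → μ F ≤ ν F := by
    intro F hF
    have hpos : ∀ n : ℕ, (0 : ℝ) < 1 / ((n : ℝ) + 1) := fun n => Nat.one_div_pos_of_nat
    have hμ := tendsto_integral_thickenedIndicator_of_isClosed μ hF hpos
      tendsto_one_div_add_atTop_nhds_zero_nat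
    have hν := tendsto_integral_thickenedIndicator_of_isClosed ν hF hpos
      tendsto_one_div_add_atTop_nhds_zero_nat
    have hle : μ.real F ≤ ν.real F := le_of_tendsto_of_tendsto' hμ hν fun n =>
      h ⟨fun y => (thickenedIndicator (hpos n) F y : ℝ), by fun_prop⟩ fun y => NNReal.coe_nonneg _
    exact (ENNReal.toReal_le_toReal (measure_ne_top _ _) (measure_ne_top _ _)).1 hle
  refine Measure.le_iff.2 fun s hs => ?_
  rw [hs.measure_eq_iSup_isClosed_of_ne_top (measure_ne_top μ s)]
  exact iSup₂_le fun F hFs => iSup_le fun hF => (hclosed F hF).trans (measure_mono hFs)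

/-- Measures on the product with first marginal `μ` and second marginal at most `ν`. -/
def partialPlans {X : Type*} [MeasurableSpace X] (μ ν : Measure X) : Set (Measure (X × X)) :=
  {γ | γ.map Prod.fst = μ ∧ γ.map Prod.snd ≤ ν}

/-- The values `∫ φ dμ + ∫ ψ dν` over continuous `φ` and `ψ ≥ 0` with `u ≤ φ ⊕ ψ`. -/
def majorantValues {X : Type*} [MeasurableSpace X] [TopologicalSpace X] (μ ν : Measure X)
    (u : C(X × X, ℝ)) : Set ℝ :=
  {r | ∃ φ ψ : C(X, ℝ), 0 ≤ ψ ∧ (∀ x y, u (x, y) ≤ φ x + ψ y) ∧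
    ∫ x, φ x ∂μ + ∫ y, ψ y ∂ν = r}

theorem majorantValues_nonempty {X : Type*} [TopologicalSpace X] [CompactSpace X]
    [MeasurableSpace X] {μ ν : Measure X} (u : C(X × X, ℝ)) : (majorantValues μ ν u).Nonempty :=
  ⟨_, ContinuousMap.const X ‖u‖, 0, le_rfl,
    fun x y => by simpa using (le_abs_self _).trans (u.norm_coe_le_norm (x, y)), rfl⟩

theorem mul_mem_majorantValues {X : Type*} [TopologicalSpace X] [MeasurableSpace X]
    {μ ν : Measure X} {u : C(X × X, ℝ)} {r t : ℝ} (ht : 0 ≤ t)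
    (hr : r ∈ majorantValues μ ν u) : t * r ∈ majorantValues μ ν (t • u) := by
  obtain ⟨φ, ψ, hψ, hu, rfl⟩ := hr
  refine ⟨t • φ, t • ψ, smul_nonneg ht hψ, fun x y => ?_, ?_⟩
  · simpa [mul_add] using mul_le_mul_of_nonneg_left (hu x y) ht
  · simp [integral_const_mul, mul_add]

theorem majorantValues_smul {X : Type*} [TopologicalSpace X] [MeasurableSpace X]
    {μ ν : Measure X} {t : ℝ} (ht : 0 < t) (u : C(X × X, ℝ)) :
    majorantValues μ ν (t • u) = t • majorantValues μ ν u := by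
  ext r
  rw [Set.mem_smul_set_iff_inv_smul_mem₀ ht.ne', smul_eq_mul]
  constructor
  · intro hr
    simpa [smul_smul, ht.ne'] using mul_mem_majorantValues (inv_nonneg.2 ht.le) hr
  · intro hr
    simpa [ht.ne'] using mul_mem_majorantValues ht.le hr

theorem partialPlans_nonempty {X : Type*} [MeasurableSpace X] (μ ν : Measure X)
    [IsFiniteMeasure μ] [IsFiniteMeasure ν] (h : μ univ ≤ ν univ) :
    (partialPlans μ ν).Nonempty := by
  by_cases hν : ν univ = 0
  · have hμ : μ = 0 := Measure.measure_univ_eq_zero.1 (le_antisymm (h.trans hν.le) zero_le)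
    exact ⟨0, by simp [hμ], by simp [Measure.zero_le]⟩
  · refine ⟨(ν univ)⁻¹ • μ.prod ν, ?_, ?_⟩
    · rw [Measure.map_smul, Measure.map_fst_prod, smul_smul,
        ENNReal.inv_mul_cancel hν (measure_ne_top _ _), one_smul]
    · rw [Measure.map_smul, Measure.map_snd_prod, smul_smul]
      have hle : (ν univ)⁻¹ * μ univ ≤ 1 := by
        rw [mul_comm, ← div_eq_mul_inv]
        exact ENNReal.div_le_of_le_mul (by simpa using h)
      refine Measure.le_iff.2 fun s _ => ?_
      rw [Measure.smul_apply, smul_eq_mul]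
      exact mul_le_of_le_one_left zero_le hle

theorem isFiniteMeasure_of_mem_partialPlans {X : Type*} [MeasurableSpace X] {μ ν : Measure X}
    [IsFiniteMeasure μ] {γ : Measure (X × X)} (hγ : γ ∈ partialPlans μ ν) :
    IsFiniteMeasure γ := by
  have h : IsFiniteMeasure (γ.map Prod.fst) := by
    rw [hγ.1]
    infer_instance
  exact Measure.isFiniteMeasure_of_map measurable_fst.aemeasurable

section Duality

variable {X : Type*} [MetricSpace X] [CompactSpace X] [MeasurableSpace X] [BorelSpace X]
  {μ ν : Measure X} [IsFiniteMeasure μ] [IsFiniteMeasure ν]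

theorem integral_le_of_mem_majorantValues {γ : Measure (X × X)} (hγ : γ ∈ partialPlans μ ν)
    {u : C(X × X, ℝ)} {r : ℝ} (hr : r ∈ majorantValues μ ν u) : ∫ p, u p ∂γ ≤ r := by
  obtain ⟨φ, ψ, hψ, hu, rfl⟩ := hr
  have := isFiniteMeasure_of_mem_partialPlans hγ
  have hφi : Integrable (fun p : X × X => φ p.1) γ :=
    (φ.comp ContinuousMap.fst).integrable_of_compactSpace γ
  have hψi : Integrable (fun p : X × X => ψ p.2) γ :=
    (ψ.comp ContinuousMap.snd).integrable_of_compactSpace γ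
  calc ∫ p, u p ∂γ ≤ ∫ p, (φ p.1 + ψ p.2) ∂γ :=
        integral_mono (u.integrable_of_compactSpace γ) (hφi.add hψi) fun p => hu p.1 p.2
    _ = ∫ x, φ x ∂(γ.map Prod.fst) + ∫ y, ψ y ∂(γ.map Prod.snd) := by
        rw [integral_add hφi hψi,
          integral_map measurable_fst.aemeasurable φ.continuous.aestronglyMeasurable,
          integral_map measurable_snd.aemeasurable ψ.continuous.aestronglyMeasurable]
    _ ≤ ∫ x, φ x ∂μ + ∫ y, ψ y ∂ν := by
        rw [hγ.1]
        exact add_le_add le_rfl (integral_mono_measure hγ.2 (Eventually.of_forall hψ)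
          (ψ.integrable_of_compactSpace ν))

theorem bddBelow_majorantValues (h : μ univ ≤ ν univ) (u : C(X × X, ℝ)) :
    BddBelow (majorantValues μ ν u) := by
  obtain ⟨γ, hγ⟩ := partialPlans_nonempty μ ν h
  exact ⟨_, fun r hr => integral_le_of_mem_majorantValues hγ hr⟩

theorem add_mem_majorantValues {u v : C(X × X, ℝ)} {r s : ℝ}
    (hr : r ∈ majorantValues μ ν u) (hs : s ∈ majorantValues μ ν v) :
    r + s ∈ majorantValues μ ν (u + v) := by
  obtain ⟨φ, ψ, hψ, hu, rfl⟩ := hr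
  obtain ⟨φ', ψ', hψ', hv, rfl⟩ := hs
  refine ⟨φ + φ', ψ + ψ', add_nonneg hψ hψ', fun x y => ?_, ?_⟩
  · have h₁ := hu x y
    have h₂ := hv x y
    simp only [ContinuousMap.add_apply]
    linarith
  · simp only [ContinuousMap.add_apply]
    rw [integral_add (φ.integrable_of_compactSpace μ) (φ'.integrable_of_compactSpace μ),
      integral_add (ψ.integrable_of_compactSpace ν) (ψ'.integrable_of_compactSpace ν)]
    ring

theorem sInf_majorantValues_add_le (h : μ univ ≤ ν univ) (u v : C(X × X, ℝ)) :
    sInf (majorantValues μ ν (u + v)) ≤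
      sInf (majorantValues μ ν u) + sInf (majorantValues μ ν v) := by
  rw [← sub_le_iff_le_add]
  refine le_csInf (majorantValues_nonempty u) fun r hr => ?_
  rw [sub_le_iff_le_add', ← sub_le_iff_le_add]
  refine le_csInf (majorantValues_nonempty v) fun s hs => ?_
  rw [sub_le_iff_le_add']
  exact csInf_le (bddBelow_majorantValues h _) (add_mem_majorantValues hr hs)

/-- Kantorovich duality with attainment, for plans whose second marginal is only bounded above. -/
theorem exists_partialPlan_integral_eq_sInf (h : μ univ ≤ ν univ) (u : C(X × X, ℝ)) :
    ∃ γ ∈ partialPlans μ ν, ∫ p, u p ∂γ = sInf (majorantValues μ ν u) := by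
  obtain ⟨L, hLu, hL⟩ := exists_linear_eq_of_sublinear
    (fun v : C(X × X, ℝ) => sInf (majorantValues μ ν v))
    (fun t ht v => by
      rw [majorantValues_smul ht, Real.sInf_smul_of_nonneg ht.le, smul_eq_mul])
    (sInf_majorantValues_add_le h) u
  have hL' : ∀ (v : C(X × X, ℝ)) (r : ℝ), r ∈ majorantValues μ ν v → L v ≤ r := fun v r hr =>
    (hL v).trans (csInf_le (bddBelow_majorantValues h v) hr)
  obtain ⟨γ, hγ, hγL⟩ := exists_finite_measure_of_nonneg_linear L fun v hv => by
    have h₀ : L (-v) ≤ 0 := hL' _ _ ⟨0, 0, le_rfl, fun x y => by simpa using hv (x, y), by simp⟩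
    simpa using h₀
  refine ⟨γ, ⟨?_, ?_⟩, (hγL u).trans hLu⟩
  · have hle : ∀ φ : C(X, ℝ), L (φ.comp ContinuousMap.fst) ≤ ∫ x, φ x ∂μ := fun φ =>
      hL' _ _ ⟨φ, 0, le_rfl, fun x y => by simp, by simp⟩
    refine ext_of_forall_integral_eq_of_IsFiniteMeasure fun φ => ?_
    rw [integral_map measurable_fst.aemeasurable φ.continuous.aestronglyMeasurable]
    refine (hγL (φ.toContinuousMap.comp ContinuousMap.fst)).trans (le_antisymm (hle _) ?_)
    have hneg := hle (-φ.toContinuousMap)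
    have hcomp : (-φ.toContinuousMap).comp (ContinuousMap.fst : C(X × X, X)) =
        -(φ.toContinuousMap.comp ContinuousMap.fst) := rfl
    rw [hcomp, map_neg] at hneg
    simp only [ContinuousMap.neg_apply, integral_neg] at hneg
    exact neg_le_neg_iff.1 hneg
  · refine measure_le_of_forall_integral_le fun ψ hψ => ?_
    rw [integral_map measurable_snd.aemeasurable ψ.continuous.aestronglyMeasurable]
    exact (hγL (ψ.comp ContinuousMap.snd)).trans_le
      (hL' _ _ ⟨0, ψ, hψ, fun x y => by simp, by simp⟩)

theorem sInf_integral_partialPlans_eq (h : μ univ ≤ ν univ) (c : C(X × X, ℝ)) :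
    sInf ((fun γ : Measure (X × X) => ∫ p, c p ∂γ) '' partialPlans μ ν) =
      -sInf (majorantValues μ ν (-c)) := by
  obtain ⟨γ, hγ, hγc⟩ := exists_partialPlan_integral_eq_sInf h (-c)
  have hneg : ∀ γ : Measure (X × X), ∫ p, c p ∂γ = -∫ p, (-c) p ∂γ := fun γ => by
    simp [integral_neg]
  refine IsLeast.csInf_eq ⟨⟨γ, hγ, by rw [← hγc]; exact hneg γ⟩, ?_⟩
  rintro _ ⟨γ', hγ', rfl⟩
  simp only [hneg γ']
  exact neg_le_neg (le_csInf (majorantValues_nonempty _) fun r hr =>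
    integral_le_of_mem_majorantValues hγ' hr)

end Duality

theorem integral_withDensity_ofReal {X : Type*} [MeasurableSpace X] (lam : Measure X)
    {g : X → ℝ} (hg : Measurable g) (hg₀ : ∀ x, 0 ≤ g x) (φ : X → ℝ) :
    ∫ x, φ x ∂(lam.withDensity fun x => ENNReal.ofReal (g x)) = ∫ x, g x * φ x ∂lam := by
  rw [integral_withDensity_eq_integral_toReal_smul hg.ennreal_ofReal (by simp)]
  simp [ENNReal.toReal_ofReal (hg₀ _)]

theorem isFiniteMeasure_withDensity_ofReal_of_le_one {X : Type*} [MeasurableSpace X]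
    (lam : Measure X) [IsFiniteMeasure lam] {g : X → ℝ} (hg : ∀ x, g x ≤ 1) :
    IsFiniteMeasure (lam.withDensity fun x => ENNReal.ofReal (g x)) := by
  refine isFiniteMeasure_withDensity (ne_top_of_le_ne_top (measure_ne_top lam univ) ?_)
  rw [← lintegral_one]
  exact lintegral_mono fun x => ENNReal.ofReal_le_one.2 (hg x)

theorem Kfun_eq_integral_add_integral {X : Type*} [MetricSpace X] [CompactSpace X]
    [MeasurableSpace X] [BorelSpace X] (lam : Measure X) [IsFiniteMeasure lam] {f : X → ℝ}
    (hf : Measurable f) (hf₀₁ : ∀ x, 0 ≤ f x ∧ f x ≤ 1) (φ ψ : C(X, ℝ)) :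
    Kfun lam f φ ψ = ∫ x, φ x ∂(lam.withDensity fun x => ENNReal.ofReal (f x)) +
      ∫ x, ψ x ∂(lam.withDensity fun x => ENNReal.ofReal (1 - f x)) := by
  have hf' : Measurable fun x => 1 - f x := hf.const_sub 1
  rw [integral_withDensity_ofReal lam hf fun x => (hf₀₁ x).1,
    integral_withDensity_ofReal lam hf' fun x => sub_nonneg.2 (hf₀₁ x).2]
  refine integral_add ?_ ?_
  · refine (φ.integrable_of_compactSpace lam).bdd_mul (c := 1) hf.aestronglyMeasurable ?_
    exact Eventually.of_forall fun x => by
      rw [Real.norm_of_nonneg (hf₀₁ x).1]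
      exact (hf₀₁ x).2
  · refine (ψ.integrable_of_compactSpace lam).bdd_mul (c := 1) hf'.aestronglyMeasurable ?_
    exact Eventually.of_forall fun x => by
      rw [Real.norm_of_nonneg (sub_nonneg.2 (hf₀₁ x).2)]
      linarith [(hf₀₁ x).1]

theorem UpsStarC_eq_neg_sInf {X : Type*} [MetricSpace X] [CompactSpace X]
    [MeasurableSpace X] [BorelSpace X] (lam : Measure X) [IsFiniteMeasure lam] {f : X → ℝ}
    (hf : Measurable f) (hf₀₁ : ∀ x, 0 ≤ f x ∧ f x ≤ 1) (c : C(X × X, ℝ)) :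
    UpsStarC c lam f = -sInf (majorantValues (lam.withDensity fun x => ENNReal.ofReal (f x))
      (lam.withDensity fun x => ENNReal.ofReal (1 - f x)) (-c)) := by
  rw [← Real.sSup_neg, UpsStarC]
  congr 1
  ext r
  constructor
  · rintro ⟨⟨φ, ψ⟩, ⟨hφ, hψ, hψ₀, hle⟩, rfl⟩
    refine ⟨-⟨φ, hφ⟩, -⟨ψ, hψ⟩, neg_nonneg.2 hψ₀, fun x y => ?_, ?_⟩
    · have hxy := hle x y
      simp only [ContinuousMap.neg_apply, ContinuousMap.coe_mk] at hxy ⊢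
      linarith
    · have hK := Kfun_eq_integral_add_integral lam hf hf₀₁ ⟨φ, hφ⟩ ⟨ψ, hψ⟩
      simp only [ContinuousMap.neg_apply, ContinuousMap.coe_mk, integral_neg] at hK ⊢
      rw [hK]
      ring
  · rintro ⟨φ, ψ, hψ₀, hle, hr⟩
    refine ⟨(⇑(-φ), ⇑(-ψ)), ⟨(-φ).continuous, (-ψ).continuous, fun y => ?_, fun x y => ?_⟩, ?_⟩
    · simpa using hψ₀ y
    · have hxy := hle x y
      simp only [ContinuousMap.neg_apply] at hxy ⊢
      linarith
    · have hK := Kfun_eq_integral_add_integral lam hf hf₀₁ (-φ) (-ψ)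
      simp only [ContinuousMap.neg_apply, integral_neg] at hK
      dsimp only
      rw [hK]
      linarith

theorem MemL1mC.withDensity_univ_le {X : Type*} [MeasurableSpace X] {lam : Measure X}
    [IsFiniteMeasure lam] {m : ℝ} {f : X → ℝ} (hf : MemL1mC lam m f)
    (hm : 2 * m ≤ (lam univ).toReal) :
    lam.withDensity (fun x => ENNReal.ofReal (f x)) univ ≤
      lam.withDensity (fun x => ENNReal.ofReal (1 - f x)) univ := by
  obtain ⟨hfm, hf₀₁, hfi⟩ := hf
  have hint : Integrable f lam := .of_bound hfm.aestronglyMeasurable 1 <|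
    Eventually.of_forall fun x => by
      rw [Real.norm_of_nonneg (hf₀₁ x).1]
      exact (hf₀₁ x).2
  rw [withDensity_apply _ MeasurableSet.univ, withDensity_apply _ MeasurableSet.univ,
    setLIntegral_univ, setLIntegral_univ,
    ← ofReal_integral_eq_lintegral_ofReal hint (Eventually.of_forall fun x => (hf₀₁ x).1),
    ← ofReal_integral_eq_lintegral_ofReal (f := fun x => 1 - f x) ((integrable_const 1).sub hint)
      (Eventually.of_forall fun x => sub_nonneg.2 (hf₀₁ x).2)]
  refine ENNReal.ofReal_le_ofReal ?_
  rw [integral_sub (integrable_const 1) hint]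
  simp only [integral_const, smul_eq_mul, mul_one, Measure.real]
  linarith

/-- no duality gap, `Υ*(f) = Υ(f)`, on a compact metric space with a positive
finite Radon measure and continuous cost, for `f ∈ L¹_m` with `0 < m ≤ λ(X)/2`. -/
theorem stmt_5 {X : Type*} [MetricSpace X] [CompactSpace X] [MeasurableSpace X] [BorelSpace X]
    (lam : Measure X) [IsFiniteMeasure lam] [lam.Regular] (hlam : lam Set.univ ≠ 0)
    (c : X × X → ℝ) (hc : Continuous c)
    (m : ℝ) (hm : 0 < m) (hm2 : 2 * m ≤ (lam Set.univ).toReal)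
    (f : X → ℝ) (hf : MemL1mC lam m f) :
    UpsStarC c lam f = UpsC c lam f := by
  have := isFiniteMeasure_withDensity_ofReal_of_le_one lam (g := f) fun x => (hf.2.1 x).2
  have := isFiniteMeasure_withDensity_ofReal_of_le_one lam (g := fun x => 1 - f x)
    fun x => sub_le_self 1 (hf.2.1 x).1
  rw [UpsC]
  exact (UpsStarC_eq_neg_sInf lam hf.1 hf.2.1 ⟨c, hc⟩).trans
    (sInf_integral_partialPlans_eq (hf.withDensity_univ_le hm2) ⟨c, hc⟩).symm
end
end

section
/- Let (X,d_X) be a compact metric space, λ a positive Radon measure on X with λ(X) > 0, c ∈ C(X×X,ℝ) and 0 < m ≤ λ(X)/2. For f ∈ L^1_m define Ψ_f := {ψ : ψ = (φ^c)_− for some φ ∈ Φ' and K_f(ψ^{c̄}, ψ) = Υ*(f)}. Then: (i) Ψ_f admits a maximal element ψ_f for the pointwise order ≤ (i.e. ψ_f ∈ Ψ_f and ψ ≤ ψ_f for every ψ ∈ Ψ_f); (ii) if f_1, f_2 ∈ L^1_m satisfy f_1 ≤ f_2, then ψ_{f_1} ≥ ψ_{f_2}. -/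
open MeasureTheory ENNReal Filter Set

noncomputable section

/-- The set `Ψ_f` of optimal dual potentials of the form `(φ^c)_-`, `φ ∈ Φ'`. -/
def PsiSet {X : Type*} [MetricSpace X] [MeasurableSpace X] (c : X × X → ℝ)
    (lam : Measure X) (f : X → ℝ) : Set (X → ℝ) :=
  {ψ | (∃ φ ∈ PhiP c, ψ = negp (ctr c ⇑φ)) ∧ Kfun lam f (cbtr c ψ) ψ = UpsStarC c lam f}

/-- `ψf` is the maximal element of `Ψ_f` for the pointwise order. -/
def IsMaxPsi {X : Type*} [MetricSpace X] [MeasurableSpace X] (c : X × X → ℝ)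
    (lam : Measure X) (f : X → ℝ) (ψf : X → ℝ) : Prop :=
  ψf ∈ PsiSet c lam f ∧ ∀ ψ ∈ PsiSet c lam f, ∀ x, ψ x ≤ ψf x

section DualPotentials

variable {X : Type*}

/-- `u` has the modulus of continuity of the cost `c` in either variable. -/
def HasCostModulus (c : X × X → ℝ) (u : X → ℝ) : Prop :=
  ∀ x x' ε, (∀ y, |c (x, y) - c (x', y)| ≤ ε ∧ |c (y, x) - c (y, x')| ≤ ε) → |u x - u x'| ≤ ε

/-- Admissible pairs in the dual problem. -/
def IsDualPair [TopologicalSpace X] (c : X × X → ℝ) (φ ψ : X → ℝ) : Prop :=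
  Continuous φ ∧ Continuous ψ ∧ (∀ y, ψ y ≤ 0) ∧ ∀ x y, φ x + ψ y ≤ c (x, y)

/-- Functions bounded by `B` with the modulus of continuity of the cost. -/
def costBox [TopologicalSpace X] (c : X × X → ℝ) (B : ℝ) : Set C(X, ℝ) :=
  {u | (∀ x, |u x| ≤ B) ∧ HasCostModulus c u}

lemma HasCostModulus.of_swap {c : X × X → ℝ} {u : X → ℝ}
    (h : HasCostModulus (fun p => c (p.2, p.1)) u) : HasCostModulus c u :=
  fun x x' ε hε => h x x' ε fun y => ⟨(hε y).2, (hε y).1⟩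

lemma HasCostModulus.negp {c : X × X → ℝ} {u : X → ℝ} (h : HasCostModulus c u) :
    HasCostModulus c (negp u) := fun x x' ε hε =>
  (abs_min_sub_min_le_max _ _ _ _).trans
    (max_le (h x x' ε hε) (by simpa using (abs_nonneg _).trans (h x x' ε hε)))

lemma HasCostModulus.sub_const {c : X × X → ℝ} {u : X → ℝ} (h : HasCostModulus c u) (t : ℝ) :
    HasCostModulus c (fun x => u x - t) := fun x x' ε hε => by
  simpa using h x x' ε hε

lemma isClosed_setOf_hasCostModulus (c : X × X → ℝ) :
    IsClosed {u : X → ℝ | HasCostModulus c u} := by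
  simp only [HasCostModulus, ofPred_forall]
  refine isClosed_iInter fun x => isClosed_iInter fun x' => isClosed_iInter fun ε =>
    isClosed_iInter fun _ => isClosed_le ?_ continuous_const
  fun_prop

lemma isClosed_setOf_isDualPair [TopologicalSpace X] (c : X × X → ℝ) :
    IsClosed {p : C(X, ℝ) × C(X, ℝ) | IsDualPair c p.1 p.2} := by
  have : {p : C(X, ℝ) × C(X, ℝ) | IsDualPair c p.1 p.2} =
      (⋂ y, {p | p.2 y ≤ 0}) ∩ ⋂ x, ⋂ y, {p | p.1 x + p.2 y ≤ c (x, y)} := by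
    ext p
    simp [IsDualPair, p.1.continuous, p.2.continuous]
  rw [this]
  refine (isClosed_iInter fun y => isClosed_le ?_ continuous_const).inter
    (isClosed_iInter fun x => isClosed_iInter fun y => isClosed_le ?_ continuous_const) <;> fun_prop

section Transforms

variable {c : X × X → ℝ} {ζ : X → ℝ}

lemma le_cbtr [Nonempty X] {x : X} {a : ℝ} (h : ∀ y, a ≤ c (x, y) - ζ y) : a ≤ cbtr c ζ x :=
  le_ciInf h

lemma le_ctr [Nonempty X] {y : X} {a : ℝ} (h : ∀ x, a ≤ c (x, y) - ζ x) : a ≤ ctr c ζ y :=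
  le_ciInf h

variable [TopologicalSpace X] [CompactSpace X]

lemma cbtr_le (hc : Continuous c) (hζ : Continuous ζ) (x y : X) :
    cbtr c ζ x ≤ c (x, y) - ζ y := by
  have : Continuous fun y => c (x, y) - ζ y := by fun_prop
  exact ciInf_le (isCompact_range this).bddBelow y

lemma ctr_le (hc : Continuous c) (hζ : Continuous ζ) (x y : X) :
    ctr c ζ y ≤ c (x, y) - ζ x :=
  cbtr_le (c := fun p => c (p.2, p.1)) (by fun_prop) hζ y x

lemma hasCostModulus_cbtr [Nonempty X] (hc : Continuous c) (hζ : Continuous ζ) :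
    HasCostModulus c (cbtr c ζ) := by
  intro x x' ε hε
  rw [abs_sub_le_iff]
  constructor
  · have : cbtr c ζ x - ε ≤ cbtr c ζ x' := le_cbtr fun y => by
      have h₁ := cbtr_le hc hζ x y
      have h₂ := (abs_sub_le_iff.1 (hε y).1).1
      linarith
    linarith
  · have : cbtr c ζ x' - ε ≤ cbtr c ζ x := le_cbtr fun y => by
      have h₁ := cbtr_le hc hζ x' y
      have h₂ := (abs_sub_le_iff.1 (hε y).1).2
      linarith
    linarith

lemma hasCostModulus_ctr [Nonempty X] (hc : Continuous c) (hζ : Continuous ζ) :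
    HasCostModulus c (ctr c ζ) :=
  (hasCostModulus_cbtr (c := fun p => c (p.2, p.1)) (by fun_prop) hζ).of_swap

end Transforms

section Compactness

variable [MetricSpace X] [CompactSpace X] {c : X × X → ℝ}

lemma exists_delta_hasCostModulus (hc : Continuous c) {ε : ℝ} (hε : 0 < ε) :
    ∃ δ > 0, ∀ u : X → ℝ, HasCostModulus c u → ∀ x x', dist x x' < δ → |u x - u x'| < ε := by
  obtain ⟨δ, hδ, h⟩ := Metric.uniformContinuous_iff.1
    (CompactSpace.uniformContinuous_of_continuous hc) (ε / 2) (half_pos hε)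
  refine ⟨δ, hδ, fun u hu x x' hx => (hu x x' (ε / 2) fun y => ⟨?_, ?_⟩).trans_lt (half_lt_self hε)⟩
  · exact (h (a := (x, y)) (b := (x', y)) (by simpa [Prod.dist_eq, hδ] using hx)).le
  · exact (h (a := (y, x)) (b := (y, x')) (by simpa [Prod.dist_eq, hδ] using hx)).le

lemma HasCostModulus.continuous (hc : Continuous c) {u : X → ℝ} (hu : HasCostModulus c u) :
    Continuous u := by
  refine Metric.continuous_iff.2 fun x ε hε => ?_
  obtain ⟨δ, hδ, h⟩ := exists_delta_hasCostModulus hc hε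
  exact ⟨δ, hδ, fun y hy => h u hu y x hy⟩

lemma isCompact_costBox (hc : Continuous c) (B : ℝ) : IsCompact (costBox c B) := by
  refine ArzelaAscoli.isCompact_of_equicontinuous _ ?_ ?_
  · have himage : ContinuousMap.toFun '' costBox c B =
        univ.pi (fun _ => Icc (-B) B) ∩ {u : X → ℝ | HasCostModulus c u} := by
      ext u
      constructor
      · rintro ⟨v, hv, rfl⟩
        exact ⟨fun x _ => abs_le.1 (hv.1 x), hv.2⟩
      · rintro ⟨h₁, h₂⟩
        exact ⟨⟨u, h₂.continuous hc⟩, ⟨fun x => abs_le.2 (h₁ x trivial), h₂⟩, rfl⟩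
    rw [himage]
    exact (isCompact_univ_pi fun _ => isCompact_Icc).inter_right (isClosed_setOf_hasCostModulus c)
  · intro x
    refine Metric.equicontinuousAt_iff.2 fun ε hε => ?_
    obtain ⟨δ, hδ, h⟩ := exists_delta_hasCostModulus hc hε
    exact ⟨δ, hδ, fun y hy u => h u u.2.2 x y (by rwa [dist_comm])⟩

lemma isDualPair_of_mem_psiSet [Nonempty X] [MeasurableSpace X]
    {lam : Measure X} {f : X → ℝ} (hc : Continuous c) {ψ : X → ℝ}
    (h : ψ ∈ PsiSet c lam f) : IsDualPair c (cbtr c ψ) ψ := by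
  obtain ⟨⟨φ, -, rfl⟩, -⟩ := h
  have hcont : Continuous (negp (ctr c φ)) :=
    (hasCostModulus_ctr hc φ.continuous).negp.continuous hc
  exact ⟨(hasCostModulus_cbtr hc hcont).continuous hc, hcont, fun y => min_le_right _ _,
    fun x y => by linarith [cbtr_le hc hcont x y]⟩

end Compactness

section Functional

variable [MeasurableSpace X] {lam : Measure X} [IsFiniteMeasure lam] {m : ℝ} {f : X → ℝ}

lemma MemL1mC.integrable (hf : MemL1mC lam m f) : Integrable f lam :=
  Integrable.of_bound hf.1.aestronglyMeasurable 1
    (ae_of_all _ fun x => by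
      rw [Real.norm_eq_abs, abs_of_nonneg (hf.2.1 x).1]
      exact (hf.2.1 x).2)

variable [MetricSpace X] [CompactSpace X] [BorelSpace X]

lemma MemL1mC.integrable_kfun (hf : MemL1mC lam m f) {φ ψ : X → ℝ} (hφ : Continuous φ)
    (hψ : Continuous ψ) : Integrable (fun x => f x * φ x + (1 - f x) * ψ x) lam := by
  have aux : ∀ u : X → ℝ, Continuous u → ∀ g : X → ℝ, Integrable g lam →
      Integrable (fun x => g x * u x) lam := fun u hu g hg => by
    obtain ⟨C, hC⟩ := isCompact_univ.exists_bound_of_continuousOn hu.continuousOn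
    exact hg.mul_bdd hu.measurable.aestronglyMeasurable (ae_of_all _ fun x => hC x trivial)
  exact (aux φ hφ f hf.integrable).add
    (aux ψ hψ (fun x => 1 - f x) ((integrable_const 1).sub hf.integrable))

lemma MemL1mC.kfun_mono (hf : MemL1mC lam m f) {φ ψ φ' ψ' : X → ℝ} (hφ : Continuous φ)
    (hψ : Continuous ψ) (hφ' : Continuous φ') (hψ' : Continuous ψ') (h₁ : ∀ x, φ x ≤ φ' x)
    (h₂ : ∀ x, ψ x ≤ ψ' x) : Kfun lam f φ ψ ≤ Kfun lam f φ' ψ' :=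
  integral_mono (hf.integrable_kfun hφ hψ) (hf.integrable_kfun hφ' hψ') fun x =>
    add_le_add (mul_le_mul_of_nonneg_left (h₁ x) (hf.2.1 x).1)
      (mul_le_mul_of_nonneg_left (h₂ x) (sub_nonneg.2 (hf.2.1 x).2))

lemma MemL1mC.kfun_le_kfun_shift (hf : MemL1mC lam m f) (hm : 2 * m ≤ (lam Set.univ).toReal)
    {φ ψ : X → ℝ} (hφ : Continuous φ) (hψ : Continuous ψ) {t : ℝ} (ht : 0 ≤ t) :
    Kfun lam f φ ψ ≤ Kfun lam f (fun x => φ x - t) (fun x => ψ x + t) := by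
  have hshift : Kfun lam f (fun x => φ x - t) (fun x => ψ x + t) =
      Kfun lam f φ ψ + t * ((lam Set.univ).toReal - 2 * ∫ x, f x ∂lam) := by
    have h : ∀ x, f x * (φ x - t) + (1 - f x) * (ψ x + t) =
        (f x * φ x + (1 - f x) * ψ x) + (t - 2 * t * f x) := fun x => by ring
    simp only [Kfun, h]
    have h_int : Integrable (fun x => t - 2 * t * f x) lam :=
      (integrable_const t).sub (hf.integrable.const_mul _)
    rw [integral_add (hf.integrable_kfun hφ hψ) h_int, integral_sub (integrable_const t) (hf.integrable.const_mul _), integral_const_mul]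
    simp [Measure.real]
    ring
  have := mul_nonneg ht (sub_nonneg.2 ((mul_le_mul_of_nonneg_left hf.2.2 zero_le_two).trans hm))
  linarith

lemma MemL1mC.continuous_kfun (hf : MemL1mC lam m f) :
    Continuous fun p : C(X, ℝ) × C(X, ℝ) => Kfun lam f p.1 p.2 := by
  refine (LipschitzWith.of_dist_le_mul (K := (lam Set.univ).toNNReal) fun p q => ?_).continuous
  rw [dist_eq_norm, Kfun, Kfun, ← integral_sub
    (hf.integrable_kfun p.1.continuous p.2.continuous)
    (hf.integrable_kfun q.1.continuous q.2.continuous), mul_comm]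
  refine (norm_integral_le_of_norm_le_const (μ := lam) (C := dist p q)
    (ae_of_all _ fun x => ?_)).trans_eq rfl
  have h₁ : |p.1 x - q.1 x| ≤ dist p q :=
    (ContinuousMap.dist_apply_le_dist (f := p.1) (g := q.1) x).trans (le_max_left _ _)
  have h₂ : |p.2 x - q.2 x| ≤ dist p q :=
    (ContinuousMap.dist_apply_le_dist (f := p.2) (g := q.2) x).trans (le_max_right _ _)
  obtain ⟨h0, h1⟩ := hf.2.1 x
  rw [Real.norm_eq_abs]
  rw [abs_le] at *
  constructor <;> nlinarith

/-- Exchange inequality: passing to the infimum and supremum of two pairs of potentials does not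
decrease the sum of the dual functionals when the densities are ordered. -/
lemma kfun_add_kfun_le {f₁ f₂ : X → ℝ} (hf₁ : MemL1mC lam m f₁) (hf₂ : MemL1mC lam m f₂)
    (hle : ∀ x, f₁ x ≤ f₂ x) {φ₁ ψ₁ φ₂ ψ₂ : X → ℝ} (hφ₁ : Continuous φ₁) (hψ₁ : Continuous ψ₁)
    (hφ₂ : Continuous φ₂) (hψ₂ : Continuous ψ₂) :
    Kfun lam f₁ φ₁ ψ₁ + Kfun lam f₂ φ₂ ψ₂ ≤
      Kfun lam f₁ (fun x => min (φ₁ x) (φ₂ x)) (fun x => max (ψ₁ x) (ψ₂ x)) +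
        Kfun lam f₂ (fun x => max (φ₁ x) (φ₂ x)) (fun x => min (ψ₁ x) (ψ₂ x)) := by
  have hmin : ∀ u v : X → ℝ, Continuous u → Continuous v → Continuous fun x => min (u x) (v x) :=
    fun _ _ hu hv => hu.min hv
  have hmax : ∀ u v : X → ℝ, Continuous u → Continuous v → Continuous fun x => max (u x) (v x) :=
    fun _ _ hu hv => hu.max hv
  have i₁ := hf₁.integrable_kfun hφ₁ hψ₁
  have i₂ := hf₂.integrable_kfun hφ₂ hψ₂
  have i₃ := hf₁.integrable_kfun (hmin _ _ hφ₁ hφ₂) (hmax _ _ hψ₁ hψ₂)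
  have i₄ := hf₂.integrable_kfun (hmax _ _ hφ₁ hφ₂) (hmin _ _ hψ₁ hψ₂)
  simp only [Kfun]
  rw [← integral_add i₁ i₂, ← integral_add i₃ i₄]
  refine integral_mono (i₁.add i₂) (i₃.add i₄) fun x => ?_
  have h := hle x
  have hφ : (f₂ x - f₁ x) * (φ₁ x - min (φ₁ x) (φ₂ x)) ≥ 0 :=
    mul_nonneg (sub_nonneg.2 h) (sub_nonneg.2 (min_le_left _ _))
  have hψ : (f₂ x - f₁ x) * (ψ₂ x - min (ψ₁ x) (ψ₂ x)) ≥ 0 :=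
    mul_nonneg (sub_nonneg.2 h) (sub_nonneg.2 (min_le_right _ _))
  have eφ : max (φ₁ x) (φ₂ x) = φ₁ x + φ₂ x - min (φ₁ x) (φ₂ x) := by
    linarith [min_add_max (φ₁ x) (φ₂ x)]
  have eψ : max (ψ₁ x) (ψ₂ x) = ψ₁ x + ψ₂ x - min (ψ₁ x) (ψ₂ x) := by
    linarith [min_add_max (ψ₁ x) (ψ₂ x)]
  simp only [eφ, eψ]
  linarith

end Functional

section Optimal

variable [MetricSpace X] [CompactSpace X] [MeasurableSpace X] [BorelSpace X]
  {lam : Measure X} [IsFiniteMeasure lam] {m : ℝ} {f : X → ℝ} {c : X × X → ℝ}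

lemma exists_mem_phiP_of_isDualPair [Nonempty X] (hc : Continuous c) (hf : MemL1mC lam m f)
    (hm : 2 * m ≤ (lam Set.univ).toReal) {C : ℝ} (hC : ∀ p, |c p| ≤ C) {φ ψ : X → ℝ}
    (h : IsDualPair c φ ψ) :
    ∃ φ' ∈ PhiP c, ∃ ψ' : C(X, ℝ), ⇑ψ' = negp (ctr c φ') ∧ cbtr c ψ' = φ' ∧
      IsDualPair c φ' ψ' ∧ (∀ y, ψ y ≤ ψ' y) ∧ Kfun lam f φ ψ ≤ Kfun lam f φ' ψ' ∧
      φ' ∈ costBox c (2 * C) ∧ ψ' ∈ costBox c (2 * C) := by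
  obtain ⟨hφ, hψ, hψ0, hadm⟩ := h
  have hφ₁m := hasCostModulus_cbtr hc hψ
  have hφ₁ := hφ₁m.continuous hc
  obtain ⟨y₀, hy₀⟩ : ∃ y₀, ∀ y, ctr c (cbtr c ψ) y ≤ ctr c (cbtr c ψ) y₀ := by
    obtain ⟨y₀, -, hy₀⟩ := isCompact_univ.exists_isMaxOn univ_nonempty
      ((hasCostModulus_ctr hc hφ₁).continuous hc).continuousOn
    exact ⟨y₀, fun y => hy₀ (mem_univ y)⟩
  set t : ℝ := max 0 (-ctr c (cbtr c ψ) y₀) with ht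
  have ht0 : 0 ≤ t := le_max_left _ _
  let φ' : C(X, ℝ) := ⟨fun x => cbtr c ψ x - t, by fun_prop⟩
  have hctr : ∀ y, ctr c φ' y = ctr c (cbtr c ψ) y + t := fun y => by
    apply le_antisymm
    · have : ctr c φ' y - t ≤ ctr c (cbtr c ψ) y := le_ctr fun x => by
        have := ctr_le hc φ'.continuous x y
        simp only [φ', ContinuousMap.coe_mk] at this ⊢
        linarith
      linarith
    · exact le_ctr fun x => by
        have := ctr_le hc hφ₁ x y
        simp only [φ', ContinuousMap.coe_mk]
        linarith
  have hψ'm : HasCostModulus c (negp (ctr c φ')) := (hasCostModulus_ctr hc φ'.continuous).negp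
  let ψ' : C(X, ℝ) := ⟨negp (ctr c φ'), hψ'm.continuous hc⟩
  have hψ'0 : ∀ y, ψ' y ≤ 0 := fun y => min_le_right _ _
  have hadm' : ∀ x y, φ' x + ψ' y ≤ c (x, y) := fun x y => by
    have h₁ := ctr_le hc φ'.continuous x y
    have h₂ : ψ' y ≤ ctr c φ' y := min_le_left _ _
    linarith
  have hy₀' : 0 ≤ ctr c φ' y₀ := by
    rw [hctr]
    linarith [le_max_right 0 (-ctr c (cbtr c ψ) y₀)]
  have hψle : ∀ y, ψ y + t ≤ ψ' y := fun y => by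
    have hle : ψ y ≤ ctr c (cbtr c ψ) y := le_ctr fun x => by
      linarith [cbtr_le hc hψ x y]
    refine le_min (by rw [hctr]; linarith) ?_
    rcases max_cases 0 (-ctr c (cbtr c ψ) y₀) with h | h
    · linarith [hψ0 y]
    · linarith [hy₀ y]
  have hfix : cbtr c ψ' = φ' := by
    funext x
    apply le_antisymm
    · have : cbtr c ψ' x + t ≤ cbtr c ψ x := le_cbtr fun y => by
        linarith [cbtr_le hc ψ'.continuous x y, hψle y]
      simp only [φ', ContinuousMap.coe_mk]
      linarith
    · exact le_cbtr fun y => by linarith [hadm' x y]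
  have hφ'C : ∀ x, |φ' x| ≤ C := fun x => by
    rw [abs_le]
    constructor
    · rw [← hfix]
      exact le_cbtr fun y => by linarith [(abs_le.1 (hC (x, y))).1, hψ'0 y]
    · have : ψ' y₀ = 0 := min_eq_right hy₀'
      linarith [hadm' x y₀, (abs_le.1 (hC (x, y₀))).2]
  refine ⟨φ', ⟨hfix.symm, y₀, hy₀'⟩, ψ', rfl, hfix,
    ⟨φ'.continuous, ψ'.continuous, hψ'0, hadm'⟩, fun y => by linarith [hψle y], ?_,
    ⟨fun x => ?_, hφ₁m.sub_const t⟩, fun y => ?_, hψ'm⟩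
  · calc Kfun lam f φ ψ ≤ Kfun lam f (cbtr c ψ) ψ :=
          hf.kfun_mono hφ hψ hφ₁ hψ
            (fun x => le_cbtr fun y => by linarith [hadm x y]) fun _ => le_rfl
      _ ≤ Kfun lam f (fun x => cbtr c ψ x - t) (fun x => ψ x + t) :=
          hf.kfun_le_kfun_shift hm hφ₁ hψ ht0
      _ ≤ Kfun lam f φ' ψ' :=
          hf.kfun_mono φ'.continuous (by fun_prop) φ'.continuous ψ'.continuous
            (fun _ => le_rfl) hψle
  · linarith [hφ'C x, abs_nonneg (φ' x)]
  · have hC0 : 0 ≤ C := (abs_nonneg _).trans (hφ'C y)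
    refine abs_le.2 ⟨le_min (le_ctr fun x => ?_) (by linarith), by linarith [hψ'0 y]⟩
    linarith [(abs_le.1 (hC (x, y))).1, (abs_le.1 (hφ'C x)).2]

lemma isGreatest_upsStarC [Nonempty X] (hc : Continuous c) (hf : MemL1mC lam m f)
    (hm : 2 * m ≤ (lam Set.univ).toReal) :
    IsGreatest ((fun p : (X → ℝ) × (X → ℝ) => Kfun lam f p.1 p.2) ''
      {p | IsDualPair c p.1 p.2}) (UpsStarC c lam f) := by
  obtain ⟨C, hC⟩ := isCompact_univ.exists_bound_of_continuousOn hc.continuousOn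
  replace hC : ∀ p, |c p| ≤ C := fun p => hC p trivial
  have hcomp : IsCompact ((costBox c (2 * C) ×ˢ costBox c (2 * C)) ∩
      {p : C(X, ℝ) × C(X, ℝ) | IsDualPair c p.1 p.2}) :=
    ((isCompact_costBox hc _).prod (isCompact_costBox hc _)).inter_right
      (isClosed_setOf_isDualPair c)
  have himp := fun (φ ψ : X → ℝ) (h : IsDualPair c φ ψ) =>
    exists_mem_phiP_of_isDualPair hc hf hm hC h
  have hpair : IsDualPair c (fun _ => -C) (fun _ => 0) :=
    ⟨continuous_const, continuous_const, fun _ => le_rfl, fun x y => by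
      linarith [(abs_le.1 (hC (x, y))).1]⟩
  obtain ⟨φ₀, -, ψ₀, -, -, hd₀, -, -, hb₀, hb₀'⟩ := himp _ _ hpair
  obtain ⟨p, hp, hmax⟩ := hcomp.exists_isMaxOn ⟨(φ₀, ψ₀), ⟨hb₀, hb₀'⟩, hd₀⟩
    hf.continuous_kfun.continuousOn
  have hg : IsGreatest ((fun p : (X → ℝ) × (X → ℝ) => Kfun lam f p.1 p.2) ''
      {p | IsDualPair c p.1 p.2}) (Kfun lam f p.1 p.2) := by
    refine ⟨⟨(p.1, p.2), hp.2, rfl⟩, ?_⟩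
    rintro _ ⟨q, hq, rfl⟩
    obtain ⟨φ', -, ψ', -, -, hd, -, hK, hb, hb'⟩ := himp _ _ hq
    exact hK.trans (hmax (a := (φ', ψ')) ⟨⟨hb, hb'⟩, hd⟩)
  have hval : UpsStarC c lam f = Kfun lam f p.1 p.2 := hg.csSup_eq
  rwa [hval]

lemma kfun_le_upsStarC [Nonempty X] (hc : Continuous c) (hf : MemL1mC lam m f)
    (hm : 2 * m ≤ (lam Set.univ).toReal) {φ ψ : X → ℝ} (h : IsDualPair c φ ψ) :
    Kfun lam f φ ψ ≤ UpsStarC c lam f :=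
  (isGreatest_upsStarC hc hf hm).2 ⟨(φ, ψ), h, rfl⟩

/-- Every optimal dual pair lies below an element of `Ψ_f`. -/
lemma exists_mem_psiSet_ge [Nonempty X] (hc : Continuous c) (hf : MemL1mC lam m f)
    (hm : 2 * m ≤ (lam Set.univ).toReal) {φ ψ : X → ℝ} (h : IsDualPair c φ ψ)
    (hopt : UpsStarC c lam f ≤ Kfun lam f φ ψ) :
    ∃ ψ' ∈ PsiSet c lam f, ∀ y, ψ y ≤ ψ' y := by
  obtain ⟨C, hC⟩ := isCompact_univ.exists_bound_of_continuousOn hc.continuousOn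
  obtain ⟨φ', hφ', ψ', hψ', hfix, hd, hle, hK, -, -⟩ :=
    exists_mem_phiP_of_isDualPair hc hf hm (fun p => hC p trivial) h
  refine ⟨ψ', ⟨⟨φ', hφ', hψ'⟩, ?_⟩, hle⟩
  rw [hfix]
  exact le_antisymm (kfun_le_upsStarC hc hf hm hd) (hopt.trans hK)

lemma exists_mem_psiSet_ge_ge [Nonempty X] (hc : Continuous c)
    (hm : 2 * m ≤ (lam Set.univ).toReal) {f₁ f₂ : X → ℝ} (hf₁ : MemL1mC lam m f₁)
    (hf₂ : MemL1mC lam m f₂) (hle : ∀ x, f₁ x ≤ f₂ x) {ψ₁ ψ₂ : X → ℝ}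
    (h₁ : ψ₁ ∈ PsiSet c lam f₁) (h₂ : ψ₂ ∈ PsiSet c lam f₂) :
    ∃ ψ ∈ PsiSet c lam f₁, (∀ y, ψ₁ y ≤ ψ y) ∧ ∀ y, ψ₂ y ≤ ψ y := by
  obtain ⟨hφ₁, hψ₁, hn₁, ha₁⟩ := isDualPair_of_mem_psiSet hc h₁
  obtain ⟨hφ₂, hψ₂, hn₂, ha₂⟩ := isDualPair_of_mem_psiSet hc h₂
  have hsup : IsDualPair c (fun x => min (cbtr c ψ₁ x) (cbtr c ψ₂ x))
      (fun x => max (ψ₁ x) (ψ₂ x)) := by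
    refine ⟨hφ₁.min hφ₂, hψ₁.max hψ₂, fun y => max_le (hn₁ y) (hn₂ y), fun x y => ?_⟩
    rcases max_choice (ψ₁ y) (ψ₂ y) with h | h <;> simp only [h]
    · linarith [ha₁ x y, min_le_left (cbtr c ψ₁ x) (cbtr c ψ₂ x)]
    · linarith [ha₂ x y, min_le_right (cbtr c ψ₁ x) (cbtr c ψ₂ x)]
  have hinf : IsDualPair c (fun x => max (cbtr c ψ₁ x) (cbtr c ψ₂ x))
      (fun x => min (ψ₁ x) (ψ₂ x)) := by
    refine ⟨hφ₁.max hφ₂, hψ₁.min hψ₂, fun y => min_le_of_left_le (hn₁ y), fun x y => ?_⟩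
    rcases max_choice (cbtr c ψ₁ x) (cbtr c ψ₂ x) with h | h <;> simp only [h]
    · linarith [ha₁ x y, min_le_left (ψ₁ y) (ψ₂ y)]
    · linarith [ha₂ x y, min_le_right (ψ₁ y) (ψ₂ y)]
  have hK := kfun_add_kfun_le hf₁ hf₂ hle hφ₁ hψ₁ hφ₂ hψ₂
  rw [h₁.2, h₂.2] at hK
  obtain ⟨ψ, hψ, hge⟩ := exists_mem_psiSet_ge hc hf₁ hm hsup
    (by linarith [kfun_le_upsStarC hc hf₂ hm hinf])
  exact ⟨ψ, hψ, fun y => (le_max_left _ _).trans (hge y), fun y => (le_max_right _ _).trans (hge y)⟩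

lemma exists_isMaxPsi [Nonempty X] (hc : Continuous c) (hf : MemL1mC lam m f)
    (hm : 2 * m ≤ (lam Set.univ).toReal) : ∃ ψf, IsMaxPsi c lam f ψf := by
  obtain ⟨C, hC⟩ := isCompact_univ.exists_bound_of_continuousOn hc.continuousOn
  replace hC : ∀ p, |c p| ≤ C := fun p => hC p trivial
  let S : PsiSet c lam f → Set (C(X, ℝ) × C(X, ℝ)) := fun ψ =>
    ((costBox c (2 * C) ×ˢ costBox c (2 * C)) ∩ {p | IsDualPair c p.1 p.2}) ∩
      ({p | UpsStarC c lam f ≤ Kfun lam f p.1 p.2} ∩ {p | ∀ y, ψ.1 y ≤ p.2 y})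
  have hclosed : ∀ ψ : PsiSet c lam f, IsClosed ({p : C(X, ℝ) × C(X, ℝ) |
      UpsStarC c lam f ≤ Kfun lam f p.1 p.2} ∩ {p | ∀ y, ψ.1 y ≤ p.2 y}) := fun ψ => by
    refine (isClosed_le continuous_const hf.continuous_kfun).inter ?_
    simp only [ofPred_forall]
    exact isClosed_iInter fun y => isClosed_le continuous_const (by fun_prop)
  have hcompact : ∀ ψ, IsCompact (S ψ) := fun ψ =>
    (((isCompact_costBox hc _).prod (isCompact_costBox hc _)).inter_right
      (isClosed_setOf_isDualPair c)).inter_right (hclosed ψ)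
  have : Nonempty (PsiSet c lam f) := by
    obtain ⟨p, hp, hK⟩ := (isGreatest_upsStarC hc hf hm).1
    obtain ⟨ψ, hψ, -⟩ := exists_mem_psiSet_ge hc hf hm hp hK.ge
    exact ⟨⟨ψ, hψ⟩⟩
  have hdir : Directed (· ⊇ ·) S := fun ψ₁ ψ₂ => by
    obtain ⟨ψ, hψ, h₁, h₂⟩ :=
      exists_mem_psiSet_ge_ge hc hm hf hf (fun _ => le_rfl) ψ₁.2 ψ₂.2
    exact ⟨⟨ψ, hψ⟩, fun p hp => ⟨hp.1, hp.2.1, fun y => (h₁ y).trans (hp.2.2 y)⟩,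
      fun p hp => ⟨hp.1, hp.2.1, fun y => (h₂ y).trans (hp.2.2 y)⟩⟩
  have hne : ∀ ψ, (S ψ).Nonempty := fun ψ => by
    obtain ⟨φ', -, ψ', -, -, hd, hle, hK, hb, hb'⟩ :=
      exists_mem_phiP_of_isDualPair hc hf hm hC (isDualPair_of_mem_psiSet hc ψ.2)
    exact ⟨(φ', ψ'), ⟨⟨hb, hb'⟩, hd⟩, ψ.2.2.ge.trans hK, hle⟩
  obtain ⟨p, hp⟩ := IsCompact.nonempty_iInter_of_directed_nonempty_isCompact_isClosed S hdir hne
    hcompact fun ψ => (hcompact ψ).isClosed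
  rw [mem_iInter] at hp
  obtain ⟨ψ₀⟩ := this
  obtain ⟨ψ, hψ, hle⟩ := exists_mem_psiSet_ge hc hf hm (hp ψ₀).1.2 (hp ψ₀).2.1
  exact ⟨ψ, hψ, fun ψ' hψ' x => ((hp ⟨ψ', hψ'⟩).2.2 x).trans (hle x)⟩

end Optimal

end DualPotentials

/-- (i) `Ψ_f` admits a maximal element `ψ_f` for the pointwise order;
(ii) if `f₁ ≤ f₂` then `ψ_{f₁} ≥ ψ_{f₂}`. -/
theorem stmt_7 {X : Type*} [MetricSpace X] [CompactSpace X] [MeasurableSpace X] [BorelSpace X]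
    (lam : Measure X) [IsFiniteMeasure lam] [lam.Regular] (hlam : lam Set.univ ≠ 0)
    (c : X × X → ℝ) (hc : Continuous c)
    (m : ℝ) (hm : 0 < m) (hm2 : 2 * m ≤ (lam Set.univ).toReal) :
    (∀ f : X → ℝ, MemL1mC lam m f → ∃ ψf : X → ℝ, IsMaxPsi c lam f ψf) ∧
    (∀ f₁ f₂ : X → ℝ, MemL1mC lam m f₁ → MemL1mC lam m f₂ → (∀ x, f₁ x ≤ f₂ x) →
      ∀ ψ₁ ψ₂ : X → ℝ, IsMaxPsi c lam f₁ ψ₁ → IsMaxPsi c lam f₂ ψ₂ →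
        ∀ x, ψ₂ x ≤ ψ₁ x) := by
  have : Nonempty X := by
    by_contra h
    rw [not_nonempty_iff] at h
    exact hlam (by simp [Set.univ_eq_empty_iff.2 h])
  refine ⟨fun f hf => exists_isMaxPsi hc hf hm2, fun f₁ f₂ hf₁ hf₂ hle ψ₁ ψ₂ h₁ h₂ x => ?_⟩
  obtain ⟨ψ, hψ, -, hge⟩ := exists_mem_psiSet_ge_ge hc hm2 hf₁ hf₂ hle h₁.1 h₂.1
  exact (hge x).trans (h₁.2 ψ hψ x)
end
end

section
/- Assume c(x,y) = k(y−x) with k satisfying (H1). Then for every m > 0 and every f ∈ L^1_m the infimum defining Υ(f) is attained, and for any minimiser γ, setting g := γ_y, one has Υ(f) = 𝒯_c(f·Leb, g·Leb). Moreover there exists R = R(m), non-decreasing in m, such that for every f ∈ L^1_m: Υ(f) equals the minimum of ∫ c dγ over plans γ ∈ Π_f satisfying |x − y| ≤ R for all (x,y) ∈ supp γ, and every minimiser γ of Υ(f) satisfies |x − y| ≤ R on supp γ. -/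
open MeasureTheory ENNReal Filter Set

noncomputable section

/-- Euclidean space `ℝ^d`. -/
abbrev Rd (d : ℕ) : Type := EuclideanSpace ℝ (Fin d)

/-- The measure `f · Leb` on `ℝ^d`. -/
def fMeas {d : ℕ} (f : Rd d → ℝ) : Measure (Rd d) :=
  MeasureTheory.volume.withDensity fun x => ENNReal.ofReal (f x)

/-- The set `Π_f` of admissible exterior transport plans: first marginal `f · Leb`,
second marginal `≤ (1 - f) · Leb`. -/
def ExtPlans {d : ℕ} (f : Rd d → ℝ) : Set (Measure (Rd d × Rd d)) :=
  {γ | γ.map Prod.fst = fMeas f ∧ γ.map Prod.snd ≤ fMeas fun x => 1 - f x}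

/-- The transport cost `∫ c dγ` of a plan `γ`. -/
def planCost {d : ℕ} (c : Rd d → Rd d → ℝ) (γ : Measure (Rd d × Rd d)) : ℝ≥0∞ :=
  ∫⁻ p, ENNReal.ofReal (c p.1 p.2) ∂γ

/-- The functional `Υ(f) = inf { ∫ c dγ : γ ∈ Π_f }`. -/
def Ups {d : ℕ} (c : Rd d → Rd d → ℝ) (f : Rd d → ℝ) : ℝ≥0∞ :=
  ⨅ γ ∈ ExtPlans f, planCost c γ

/-- `f ∈ L¹(ℝ^d, [0,1])`. -/
def InUnit {d : ℕ} (f : Rd d → ℝ) : Prop :=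
  Integrable f MeasureTheory.volume ∧ ∀ x, 0 ≤ f x ∧ f x ≤ 1

/-- `f ∈ L¹_m`: in `L¹(ℝ^d,[0,1])` with `∫ f ≤ m`. -/
def MemL1m {d : ℕ} (m : ℝ) (f : Rd d → ℝ) : Prop := InUnit f ∧ (∫ x, f x) ≤ m

/-- The energy `ℰ(m) = sup { Υ(f) : f ∈ L¹(ℝ^d,[0,1]), ∫ f = m }`. -/
def Energy {d : ℕ} (c : Rd d → Rd d → ℝ) (m : ℝ) : ℝ≥0∞ :=
  ⨆ f ∈ {f : Rd d → ℝ | InUnit f ∧ (∫ x, f x) = m}, Ups c f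

/-- Hypothesis (H1): `k` continuous, `k 0 = 0`, `k → ∞` at infinity. -/
def H1 {d : ℕ} (k : Rd d → ℝ) : Prop :=
  Continuous k ∧ k 0 = 0 ∧ Tendsto k (Bornology.cobounded (Rd d)) atTop

/-- Hypothesis (H2). -/
def H2 {d : ℕ} (k : Rd d → ℝ) : Prop :=
  ∀ x : Rd d, x ≠ 0 →
    0 < Filter.limsup
      (fun r : ℝ =>
        MeasureTheory.volume (Metric.ball x r ∩ {y | k y < k x}) / ENNReal.ofReal (r ^ d))
      (nhdsWithin 0 (Set.Ioi 0))

/-- Hypothesis (H3): `r ↦ k (r σ)` increasing on `[0, ∞)` for every unit direction `σ`. -/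
def H3 {d : ℕ} (k : Rd d → ℝ) : Prop :=
  ∀ σ : Rd d, ‖σ‖ = 1 → StrictMonoOn (fun r : ℝ => k (r • σ)) (Set.Ici 0)

/-- Translation-invariant cost `c(x,y) = k(y - x)`. -/
def transCost {d : ℕ} (k : Rd d → ℝ) : Rd d → Rd d → ℝ := fun x y => k (y - x)

/-- The support of a measure: points all of whose open neighbourhoods have positive measure. -/
def msupport {α : Type*} [TopologicalSpace α] [MeasurableSpace α] (μ : Measure α) : Set α :=
  {x | ∀ U : Set α, IsOpen U → x ∈ U → 0 < μ U}

/-- Couplings of two measures on `ℝ^d`. -/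
def Couplings {d : ℕ} (μ ν : Measure (Rd d)) : Set (Measure (Rd d × Rd d)) :=
  {γ | γ.map Prod.fst = μ ∧ γ.map Prod.snd = ν}

/-- The optimal transport cost `𝒯_c(μ, ν)`. -/
def Tcost {d : ℕ} (c : Rd d → Rd d → ℝ) (μ ν : Measure (Rd d)) : ℝ≥0∞ :=
  ⨅ γ ∈ Couplings μ ν, planCost c γ

/-- Integration of a nonnegative continuous function is lower semicontinuous for the weak
topology on finite measures. -/
theorem lowerSemicontinuous_lintegral_ofReal {X : Type*} [TopologicalSpace X] [MeasurableSpace X]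
    [OpensMeasurableSpace X] {φ : X → ℝ} (hφ : Continuous φ) :
    LowerSemicontinuous fun μ : FiniteMeasure X =>
      ∫⁻ x, ENNReal.ofReal (φ x) ∂(μ : Measure X) := by
  let g : ℕ → BoundedContinuousFunction X NNReal := fun n =>
    BoundedContinuousFunction.mkOfBound
      ⟨fun x => min (φ x).toNNReal n, by fun_prop⟩ n (by
        intro x y
        rw [NNReal.dist_eq, abs_sub_le_iff]
        have hx : ((min (φ x).toNNReal n : NNReal) : ℝ) ≤ n :=
          mod_cast min_le_right (φ x).toNNReal (n : NNReal)
        have hy : ((min (φ y).toNNReal n : NNReal) : ℝ) ≤ n :=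
          mod_cast min_le_right (φ y).toNNReal (n : NNReal)
        have hx' := NNReal.coe_nonneg (min (φ x).toNNReal n)
        have hy' := NNReal.coe_nonneg (min (φ y).toNNReal n)
        simp only [ContinuousMap.coe_mk]
        constructor <;> linarith)
  have hg : ∀ n x, g n x = min (φ x).toNNReal n := fun n x => rfl
  have key : (fun μ : FiniteMeasure X => ∫⁻ x, ENNReal.ofReal (φ x) ∂(μ : Measure X)) =
      fun μ : FiniteMeasure X => ⨆ n, ∫⁻ x, g n x ∂(μ : Measure X) := by
    funext μ
    rw [← lintegral_iSup]
    · refine lintegral_congr fun x => ?_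
      refine le_antisymm ?_ (iSup_le fun n => ?_)
      · obtain ⟨n, hn⟩ := exists_nat_ge (φ x).toNNReal
        refine le_iSup_of_le n ?_
        rw [hg, min_eq_left hn]
        exact le_rfl
      · rw [hg]
        exact ENNReal.coe_le_coe.2 (min_le_left _ _)
    · exact fun n => (ENNReal.continuous_coe.comp (g n).continuous).measurable
    · intro n n' hn x
      refine ENNReal.coe_le_coe.2 ?_
      rw [hg, hg]
      exact min_le_min_left _ (by exact_mod_cast hn)
  rw [key]
  refine lowerSemicontinuous_iSup fun n => Continuous.lowerSemicontinuous ?_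
  rw [continuous_iff_continuousAt]
  exact fun μ => FiniteMeasure.tendsto_iff_forall_lintegral_tendsto.1 tendsto_id (g n)

/-- A measure is dominated by an outer regular one as soon as this holds for the integrals of
nonnegative continuous functions. -/
theorem measure_le_of_forall_lintegral_le {X : Type*} [PseudoMetricSpace X]
    [MeasurableSpace X] [BorelSpace X] {μ ν : Measure X} [ν.OuterRegular]
    (h : ∀ φ : X → ℝ, Continuous φ → (∀ x, 0 ≤ φ x) →
      ∫⁻ x, ENNReal.ofReal (φ x) ∂μ ≤ ∫⁻ x, ENNReal.ofReal (φ x) ∂ν) : μ ≤ ν := by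
  have hopen : ∀ U : Set X, IsOpen U → μ U ≤ ν U := by
    intro U hU
    obtain ⟨F, hFc, hFU, hF, hFm⟩ := hU.exists_iUnion_isClosed
    rw [← hF, hFm.measure_iUnion, hF]
    refine iSup_le fun n => ?_
    obtain ⟨φ, h0, h1, h01⟩ := exists_continuous_zero_one_of_isClosed (isClosed_compl_iff.2 hU)
      (hFc n) (Set.disjoint_compl_left_iff_subset.2 (hFU n))
    calc μ (F n) = ∫⁻ x in F n, 1 ∂μ := by simp
      _ ≤ ∫⁻ x in F n, ENNReal.ofReal (φ x) ∂μ := by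
        refine setLIntegral_mono' (hFc n).measurableSet fun x hx => ?_
        simp [h1 hx]
      _ ≤ ∫⁻ x, ENNReal.ofReal (φ x) ∂μ := setLIntegral_le_lintegral _ _
      _ ≤ ∫⁻ x, ENNReal.ofReal (φ x) ∂ν := h φ φ.continuous fun x => (h01 x).1
      _ ≤ ∫⁻ x, U.indicator 1 x ∂ν := by
        refine lintegral_mono fun x => ?_
        by_cases hx : x ∈ U
        · simpa [hx] using (h01 x).2
        · simp [h0 (show x ∈ Uᶜ from hx)]
      _ = ν U := lintegral_indicator_one hU.measurableSet
  refine Measure.le_iff.2 fun s _ => ?_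
  rw [s.measure_eq_iInf_isOpen ν]
  exact le_iInf₂ fun U hsU => le_iInf fun hU => (measure_mono hsU).trans (hopen U hU)

/-- Two measures can be coupled inside the fibres of a countable partition, if in each fibre the
second measure has at least the mass of the first one. -/
theorem exists_plan_of_fibers {X ι : Type*} [MeasurableSpace X] [Countable ι]
    [MeasurableSpace ι] [MeasurableSingletonClass ι] {q : X → ι} (hq : Measurable q)
    {μ ν : Measure X} [IsFiniteMeasure μ] [SFinite ν]
    (hle : ∀ i, μ (q ⁻¹' {i}) ≤ ν (q ⁻¹' {i})) (h0 : ∀ i, ν (q ⁻¹' {i}) ≠ 0)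
    (htop : ∀ i, ν (q ⁻¹' {i}) ≠ ∞) :
    ∃ γ : Measure (X × X), γ.map Prod.fst = μ ∧ γ.map Prod.snd ≤ ν ∧
      ∀ᵐ p ∂γ, q p.1 = q p.2 := by
  have hmeas : ∀ i, MeasurableSet (q ⁻¹' {i}) := fun i => hq (measurableSet_singleton i)
  have hsum : ∀ ρ : Measure X, Measure.sum (fun i => ρ.restrict (q ⁻¹' {i})) = ρ := by
    intro ρ
    rw [← Measure.restrict_iUnion (fun i j hij => ?_) hmeas]
    · rw [← preimage_iUnion, iUnion_of_singleton, preimage_univ, Measure.restrict_univ]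
    · exact Disjoint.preimage q (by simpa using hij)
  refine ⟨Measure.sum fun i =>
    (ν (q ⁻¹' {i}))⁻¹ • (μ.restrict (q ⁻¹' {i})).prod (ν.restrict (q ⁻¹' {i})), ?_, ?_, ?_⟩
  · rw [Measure.map_sum measurable_fst.aemeasurable]
    conv_rhs => rw [← hsum μ]
    congr 1
    funext i
    rw [Measure.map_smul, Measure.map_fst_prod, Measure.restrict_apply_univ, smul_smul,
      ENNReal.inv_mul_cancel (h0 i) (htop i), one_smul]
  · rw [Measure.map_sum measurable_snd.aemeasurable]
    conv_rhs => rw [← hsum ν]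
    refine Measure.le_iff.2 fun s hs => ?_
    rw [Measure.sum_apply _ hs, Measure.sum_apply _ hs]
    refine ENNReal.tsum_le_tsum fun i => ?_
    rw [Measure.map_smul, Measure.map_snd_prod, Measure.restrict_apply_univ, smul_smul,
      Measure.smul_apply, smul_eq_mul]
    refine mul_le_of_le_one_left zero_le ?_
    calc (ν (q ⁻¹' {i}))⁻¹ * μ (q ⁻¹' {i}) ≤ (ν (q ⁻¹' {i}))⁻¹ * ν (q ⁻¹' {i}) := by
          exact mul_le_mul' le_rfl (hle i)
      _ ≤ 1 := ENNReal.inv_mul_le_one _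
  · rw [Measure.ae_sum_iff]
    intro i
    refine Measure.ae_smul_measure ?_ _
    rw [Measure.prod_restrict]
    filter_upwards [ae_restrict_mem ((hmeas i).prod (hmeas i))] with p hp
    exact hp.1.trans hp.2.symm

theorem fMeas_univ_le {d : ℕ} {m : ℝ} {f : Rd d → ℝ} (hf : MemL1m m f) :
    fMeas f univ ≤ ENNReal.ofReal m := by
  rw [fMeas, withDensity_apply _ MeasurableSet.univ, Measure.restrict_univ,
    ← ofReal_integral_eq_lintegral_ofReal hf.1.1 (Eventually.of_forall fun x => (hf.1.2 x).1)]
  exact ENNReal.ofReal_le_ofReal hf.2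

theorem isFiniteMeasure_fMeas {d : ℕ} {f : Rd d → ℝ} (hf : InUnit f) :
    IsFiniteMeasure (fMeas f) :=
  ⟨(fMeas_univ_le ⟨hf, le_rfl⟩).trans_lt ENNReal.ofReal_lt_top⟩

theorem fMeas_add_fMeas_one_sub {d : ℕ} {f : Rd d → ℝ} (hf : InUnit f) :
    fMeas f + fMeas (fun x => 1 - f x) = volume := by
  ext s hs
  rw [Measure.add_apply, fMeas, fMeas, withDensity_apply _ hs, withDensity_apply _ hs,
    ← lintegral_add_left' hf.1.aemeasurable.ennreal_ofReal.restrict]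
  have h : ∀ x, ENNReal.ofReal (f x) + ENNReal.ofReal (1 - f x) = 1 := fun x => by
    rw [← ENNReal.ofReal_add (hf.2 x).1 (sub_nonneg.2 (hf.2 x).2)]
    simp
  simp [h]

theorem fMeas_one_sub_le {d : ℕ} {f : Rd d → ℝ} (hf : InUnit f) :
    fMeas (fun x => 1 - f x) ≤ volume := by
  rw [← fMeas_add_fMeas_one_sub hf]
  exact Measure.le_add_left le_rfl

/-- A set of volume at least `a + m` has room for mass `a` outside of `f`. -/
theorem le_fMeas_one_sub {d : ℕ} {m : ℝ} {f : Rd d → ℝ} (hf : MemL1m m f) {a : ℝ≥0∞}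
    {s : Set (Rd d)} (hs : a + ENNReal.ofReal m ≤ volume s) :
    a ≤ fMeas (fun x => 1 - f x) s := by
  rw [← fMeas_add_fMeas_one_sub hf.1, Measure.add_apply, add_comm] at hs
  have h1 : fMeas f s ≤ ENNReal.ofReal m := (measure_mono (subset_univ s)).trans (fMeas_univ_le hf)
  exact (ENNReal.add_le_add_iff_left ENNReal.ofReal_ne_top).1 (hs.trans (by gcongr))

theorem exists_le_on_closedBall {d : ℕ} {k : Rd d → ℝ} (hk : Continuous k) (r : ℝ) :
    ∃ S : ℝ, ∀ z, ‖z‖ ≤ r → k z ≤ S := by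
  obtain ⟨S, hS⟩ := (isCompact_closedBall (0 : Rd d) r).bddAbove_image hk.continuousOn
  exact ⟨S, fun z hz => hS ⟨z, by simpa using hz, rfl⟩⟩

theorem exists_norm_le_of_le {d : ℕ} {k : Rd d → ℝ}
    (hk : Tendsto k (Bornology.cobounded (Rd d)) atTop) (T : ℝ) :
    ∃ r : ℝ, ∀ z, k z ≤ T → ‖z‖ ≤ r := by
  have h := hk.eventually (eventually_gt_atTop T)
  obtain ⟨r, hr⟩ := (Bornology.IsBounded.exists_norm_le
    (Bornology.isBounded_def.2 (show {z | k z ≤ T}ᶜ ∈ _ by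
      filter_upwards [h] with z hz using not_le.2 hz)))
  exact ⟨r, fun z hz => hr z hz⟩

/-- `ℝ^d` is partitioned into countably many cells of bounded diameter and volume at least `L`. -/
theorem exists_partition {d : ℕ} (hd : 1 ≤ d) {L : ℝ} (hL : 1 ≤ L) :
    ∃ q : Rd d → (Fin d → ℤ), Measurable q ∧
      (∀ z, ENNReal.ofReal L ≤ volume (q ⁻¹' {z})) ∧ (∀ z, volume (q ⁻¹' {z}) ≠ ∞) ∧
      ∃ r, ∀ x y, q x = q y → ‖y - x‖ ≤ r := by
  have hL0 : 0 < L := by linarith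
  let q : Rd d → (Fin d → ℤ) := fun x i => ⌊x i / L⌋
  have hvol : ∀ z, volume (q ⁻¹' {z}) = ENNReal.ofReal L ^ d := by
    intro z
    have hq : q ⁻¹' {z} = WithLp.ofLp ⁻¹'
        (Set.pi univ fun i => Ico ((z i : ℝ) * L) (((z i : ℝ) + 1) * L)) := by
      ext x
      simp only [mem_preimage, mem_singleton_iff, funext_iff, q, Int.floor_eq_iff, Set.mem_pi,
        mem_univ, true_imp_iff, mem_Ico, le_div_iff₀ hL0, div_lt_iff₀ hL0]
    rw [hq, (PiLp.volume_preserving_ofLp (Fin d)).measure_preimage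
      (MeasurableSet.univ_pi fun i => measurableSet_Ico).nullMeasurableSet, Real.volume_pi_Ico]
    simp [add_mul]
  refine ⟨q, ?_, fun z => ?_, fun z => ?_, √(d * L ^ 2), fun x y hxy => ?_⟩
  · exact measurable_pi_lambda _ fun i => Int.measurable_floor.comp (by fun_prop)
  · rw [hvol]
    exact le_self_pow₀ (by simpa using ENNReal.ofReal_le_ofReal hL) (by omega)
  · rw [hvol]
    exact ENNReal.pow_ne_top ENNReal.ofReal_ne_top
  · rw [EuclideanSpace.norm_eq]
    refine Real.sqrt_le_sqrt ?_
    calc ∑ i, ‖(y - x) i‖ ^ 2 ≤ ∑ _i : Fin d, L ^ 2 := by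
          refine Finset.sum_le_sum fun i _ => ?_
          have h := Int.abs_sub_lt_one_of_floor_eq_floor (congrFun hxy i)
          rw [← sub_div, abs_div, abs_of_pos hL0, div_lt_one hL0, abs_sub_comm] at h
          simpa using pow_le_pow_left₀ (abs_nonneg _) h.le 2
      _ = d * L ^ 2 := by simp

theorem extPlan_univ {d : ℕ} {f : Rd d → ℝ} {γ : Measure (Rd d × Rd d)} (hγ : γ ∈ ExtPlans f) :
    γ univ = fMeas f univ := by
  rw [← hγ.1, Measure.map_apply measurable_fst MeasurableSet.univ, preimage_univ]

theorem exists_extPlan_planCost_ne_top {d : ℕ} (hd : 1 ≤ d) {k : Rd d → ℝ} (hk : Continuous k)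
    {m : ℝ} (hm : 0 < m) {f : Rd d → ℝ} (hf : MemL1m m f) :
    ∃ γ ∈ ExtPlans f, planCost (transCost k) γ ≠ ∞ := by
  obtain ⟨q, hq, hvol, hfin, r, hr⟩ := exists_partition hd (le_max_left 1 (m + m))
  obtain ⟨S, hS⟩ := exists_le_on_closedBall hk r
  have := isFiniteMeasure_fMeas hf.1
  have hSF : SFinite (fMeas fun x => 1 - f x) := by unfold fMeas; infer_instance
  have hroom : ∀ z, ENNReal.ofReal m ≤ fMeas (fun x => 1 - f x) (q ⁻¹' {z}) := fun z => by
    refine le_fMeas_one_sub hf (le_trans ?_ (hvol z))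
    rw [← ENNReal.ofReal_add hm.le hm.le]
    exact ENNReal.ofReal_le_ofReal (le_max_right _ _)
  obtain ⟨γ, h1, h2, h3⟩ := exists_plan_of_fibers hq (μ := fMeas f)
    (ν := fMeas fun x => 1 - f x)
    (fun z => ((measure_mono (subset_univ _)).trans (fMeas_univ_le hf)).trans (hroom z))
    (fun z => ((ENNReal.ofReal_pos.2 hm).trans_le (hroom z)).ne')
    (fun z => ((fMeas_one_sub_le hf.1 _).trans_lt (hfin z).lt_top).ne)
  refine ⟨γ, ⟨h1, h2⟩, ne_of_lt ?_⟩
  calc planCost (transCost k) γ ≤ ∫⁻ _, ENNReal.ofReal S ∂γ := by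
        refine lintegral_mono_ae ?_
        filter_upwards [h3] with p hp
        exact ENNReal.ofReal_le_ofReal (hS _ (hr _ _ hp))
    _ = ENNReal.ofReal S * fMeas f univ := by rw [lintegral_const, extPlan_univ ⟨h1, h2⟩]
    _ < ∞ := ENNReal.mul_lt_top ENNReal.ofReal_lt_top (measure_lt_top _ _)

theorem continuous_transCost {d : ℕ} {k : Rd d → ℝ} (hk : Continuous k) :
    Continuous fun p : Rd d × Rd d => transCost k p.1 p.2 :=
  hk.comp (continuous_snd.sub continuous_fst)

/-- Plans with bounded cost form a weakly closed set. -/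
theorem isClosed_extPlans_planCost_le {d : ℕ} {k : Rd d → ℝ} (hk : Continuous k)
    {f : Rd d → ℝ} (hf : InUnit f) (C : ℝ≥0∞) :
    IsClosed {γ : FiniteMeasure (Rd d × Rd d) |
      (γ : Measure (Rd d × Rd d)) ∈ ExtPlans f ∧ planCost (transCost k) γ ≤ C} := by
  have := isFiniteMeasure_fMeas hf
  have hlf : IsLocallyFiniteMeasure (fMeas fun x => 1 - f x) :=
    Measure.isLocallyFiniteMeasure_of_le (fMeas_one_sub_le hf)
  let μ : FiniteMeasure (Rd d) := ⟨fMeas f, this⟩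
  have hS : {γ : FiniteMeasure (Rd d × Rd d) |
      (γ : Measure (Rd d × Rd d)) ∈ ExtPlans f ∧ planCost (transCost k) γ ≤ C} =
      {γ : FiniteMeasure (Rd d × Rd d) | γ.map Prod.fst = μ} ∩
      (⋂ (φ : Rd d → ℝ) (_ : Continuous φ) (_ : ∀ x, 0 ≤ φ x),
        {γ | ∫⁻ p, ENNReal.ofReal (φ p.2) ∂(γ : Measure (Rd d × Rd d)) ≤
          ∫⁻ x, ENNReal.ofReal (φ x) ∂(fMeas fun x => 1 - f x)}) ∩
      {γ | ∫⁻ p, ENNReal.ofReal (transCost k p.1 p.2) ∂(γ : Measure (Rd d × Rd d)) ≤ C} := by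
    ext γ
    have hmap : ∀ φ : Rd d → ℝ, Continuous φ →
        ∫⁻ p, ENNReal.ofReal (φ p.2) ∂(γ : Measure (Rd d × Rd d)) =
          ∫⁻ x, ENNReal.ofReal (φ x) ∂((γ : Measure (Rd d × Rd d)).map Prod.snd) :=
      fun φ hφ => (lintegral_map hφ.measurable.ennreal_ofReal measurable_snd).symm
    have hfst : γ.map Prod.fst = μ ↔
        (γ : Measure (Rd d × Rd d)).map Prod.fst = fMeas f := by
      rw [← FiniteMeasure.toMeasure_map]
      exact Subtype.ext_iff
    simp only [mem_inter_iff, mem_iInter, mem_ofPred_eq, hfst]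
    refine and_congr (and_congr Iff.rfl ⟨fun h φ hφ _ => ?_, fun h => ?_⟩) Iff.rfl
    · rw [hmap φ hφ]
      exact lintegral_mono' h le_rfl
    · exact measure_le_of_forall_lintegral_le fun φ hφ hφ0 => (hmap φ hφ) ▸ h φ hφ hφ0
  rw [hS]
  refine (IsClosed.inter ?_ ?_).inter ?_
  · exact isClosed_eq (FiniteMeasure.continuous_map continuous_fst) continuous_const
  · refine isClosed_iInter fun φ => isClosed_iInter fun hφ => isClosed_iInter fun _ => ?_
    exact (lowerSemicontinuous_lintegral_ofReal (hφ.comp continuous_snd)).isClosed_preimage _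
  · exact (lowerSemicontinuous_lintegral_ofReal (continuous_transCost hk)).isClosed_preimage _

/-- Plans with bounded cost are uniformly tight. -/
theorem exists_isCompact_extPlans_compl_le {d : ℕ} {k : Rd d → ℝ} (h1 : H1 k)
    {f : Rd d → ℝ} (hf : InUnit f) {C : ℝ≥0∞} (hC : C ≠ ∞) {ε : ℝ≥0∞} (hε : ε ≠ 0) :
    ∃ K : Set (Rd d × Rd d), IsCompact K ∧
      ∀ γ ∈ ExtPlans f, planCost (transCost k) γ ≤ C → γ Kᶜ ≤ ε := by
  have := isFiniteMeasure_fMeas hf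
  obtain ⟨K, hK, hKε⟩ := isTightMeasureSet_iff_exists_isCompact_measure_compl_le.1
    (isTightMeasureSet_singleton (μ := fMeas f)) (ε / 2) (ENNReal.half_pos hε)
  obtain ⟨T, hT0, hT⟩ : ∃ T : ℝ, 0 < T ∧ C / ENNReal.ofReal T ≤ ε / 2 := by
    rcases eq_or_ne ε ∞ with rfl | hεt
    · exact ⟨1, one_pos, by simp [ENNReal.top_div]⟩
    · have hfin : C / (ε / 2) ≠ ∞ := ENNReal.div_ne_top hC (ENNReal.half_pos hε).ne'
      refine ⟨(C / (ε / 2)).toReal + 1, by positivity, ?_⟩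
      rw [ENNReal.div_le_iff_le_mul (Or.inl (by simp; positivity)) (Or.inl ENNReal.ofReal_ne_top)]
      rw [mul_comm, ← ENNReal.div_le_iff_le_mul (Or.inl (ENNReal.half_pos hε).ne')
        (Or.inl (ENNReal.div_ne_top hεt two_ne_zero))]
      conv_lhs => rw [← ENNReal.ofReal_toReal hfin]
      exact ENNReal.ofReal_le_ofReal (by linarith)
  obtain ⟨r, hr⟩ := exists_norm_le_of_le h1.2.2 T
  refine ⟨(fun p : Rd d × Rd d => (p.1, p.1 + p.2)) '' (K ×ˢ Metric.closedBall 0 r),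
    (hK.prod (isCompact_closedBall _ _)).image (by fun_prop), fun γ hγ hcost => ?_⟩
  calc γ _ ≤ γ (Prod.fst ⁻¹' Kᶜ ∪
        {p | ENNReal.ofReal T ≤ ENNReal.ofReal (transCost k p.1 p.2)}) := by
        refine measure_mono fun p hp => ?_
        by_contra hcon
        simp only [mem_union, mem_preimage, mem_compl_iff, mem_ofPred_eq, not_or, not_not,
          not_le] at hcon
        refine hp ⟨(p.1, p.2 - p.1), ⟨hcon.1, ?_⟩, by simp⟩
        have := hr (p.2 - p.1) ((ENNReal.ofReal_lt_ofReal_iff hT0).1 hcon.2).le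
        simpa using this
    _ ≤ γ (Prod.fst ⁻¹' Kᶜ) +
        γ {p | ENNReal.ofReal T ≤ ENNReal.ofReal (transCost k p.1 p.2)} := measure_union_le _ _
    _ ≤ ε / 2 + ε / 2 := by
        gcongr
        · rw [← Measure.map_apply measurable_fst hK.measurableSet.compl, hγ.1]
          exact hKε _ rfl
        · refine le_trans ?_ hT
          refine (meas_ge_le_lintegral_div
            (continuous_transCost h1.1).measurable.ennreal_ofReal.aemeasurable
            (by simpa using hT0) ENNReal.ofReal_ne_top).trans ?_
          gcongr
          exact hcost
    _ = ε := ENNReal.add_halves ε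

theorem exists_planCost_eq_ups {d : ℕ} {k : Rd d → ℝ} (h1 : H1 k) {f : Rd d → ℝ}
    (hf : InUnit f) (hfin : ∃ γ ∈ ExtPlans f, planCost (transCost k) γ ≠ ∞) :
    ∃ γ ∈ ExtPlans f, planCost (transCost k) γ = Ups (transCost k) f := by
  have := isFiniteMeasure_fMeas hf
  have hfm : ∀ γ ∈ ExtPlans f, IsFiniteMeasure γ := fun γ hγ =>
    ⟨(extPlan_univ hγ).trans_lt (measure_lt_top _ _)⟩
  obtain ⟨γ₀, hγ₀, hC⟩ := hfin
  set C := planCost (transCost k) γ₀ with hCdef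
  obtain ⟨u, -, hu0, hu⟩ := exists_seq_strictAnti_tendsto (0 : NNReal)
  choose K hK hKu using fun n => exists_isCompact_extPlans_compl_le h1 hf hC
    (ENNReal.coe_ne_zero.2 (hu0 n).ne')
  have hcomp : IsCompact {γ : FiniteMeasure (Rd d × Rd d) |
      (γ : Measure (Rd d × Rd d)) ∈ ExtPlans f ∧ planCost (transCost k) γ ≤ C} := by
    refine (isCompact_setOfPred_finiteMeasure_mass_le_compl_isCompact_le (fMeas f univ).toNNReal
      hu hK (Or.inl inferInstance)).of_isClosed_subset
      (isClosed_extPlans_planCost_le h1.1 hf C) fun γ hγ => ⟨?_, fun n => ?_⟩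
    · rw [← ENNReal.coe_le_coe, ENNReal.coe_toNNReal (measure_ne_top _ _),
        FiniteMeasure.ennreal_mass, extPlan_univ hγ.1]
    · rw [← ENNReal.coe_le_coe, FiniteMeasure.ennreal_coeFn_eq_coeFn_toMeasure]
      exact hKu n _ hγ.1 hγ.2
  have hne : ({γ : FiniteMeasure (Rd d × Rd d) | (γ : Measure (Rd d × Rd d)) ∈ ExtPlans f ∧
      planCost (transCost k) γ ≤ C}).Nonempty := ⟨⟨γ₀, hfm γ₀ hγ₀⟩, hγ₀, le_rfl⟩
  obtain ⟨γ, hγ, hmin⟩ := LowerSemicontinuousOn.exists_isMinOn hne hcomp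
    ((lowerSemicontinuous_lintegral_ofReal (continuous_transCost h1.1)).lowerSemicontinuousOn _)
  refine ⟨γ, hγ.1, le_antisymm (le_iInf₂ fun γ' hγ' => ?_) (iInf₂_le _ hγ.1)⟩
  rcases le_total (planCost (transCost k) γ') C with h | h
  · exact hmin (show (⟨γ', hfm γ' hγ'⟩ : FiniteMeasure _) ∈ _ from ⟨hγ', h⟩)
  · exact hγ.2.trans h

/-- Minimisers only transport over a distance which is controlled by the mass. -/
theorem exists_dist_le_on_msupport {d : ℕ} (hd : 1 ≤ d) {k : Rd d → ℝ} (h1 : H1 k) {m : ℝ}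
    (hm : 0 < m) :
    ∃ R : ℝ, ∀ f : Rd d → ℝ, MemL1m m f → ∀ γ ∈ ExtPlans f,
      planCost (transCost k) γ = Ups (transCost k) f →
      ∀ p ∈ msupport γ, dist p.1 p.2 ≤ R := by
  obtain ⟨q, hq, hvol, hvfin, r, hr⟩ := exists_partition hd (le_max_left 1 (m + m + m))
  obtain ⟨S₀, hS₀⟩ := exists_le_on_closedBall h1.1 (r + 1)
  obtain ⟨S, hS0, hS⟩ : ∃ S : ℝ, 0 ≤ S ∧ ∀ z, ‖z‖ ≤ r + 1 → k z ≤ S :=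
    ⟨max S₀ 0, le_max_right _ _, fun z hz => (hS₀ z hz).trans (le_max_left _ _)⟩
  obtain ⟨R, hR⟩ := exists_norm_le_of_le h1.2.2 (S + 1)
  refine ⟨R, fun f hf γ hγ hmin p hp => ?_⟩
  by_contra! hpR
  have hμfin := isFiniteMeasure_fMeas hf.1
  have hγfin : IsFiniteMeasure γ := ⟨(extPlan_univ hγ).trans_lt (measure_lt_top _ _)⟩
  have hγm : γ univ ≤ ENNReal.ofReal m := (extPlan_univ hγ).trans_le (fMeas_univ_le hf)
  have hcont := continuous_transCost h1.1
  have hcm : Measurable fun p : Rd d × Rd d => ENNReal.ofReal (transCost k p.1 p.2) :=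
    hcont.measurable.ennreal_ofReal
  have hfin : planCost (transCost k) γ ≠ ∞ := by
    obtain ⟨γ₀, hγ₀, h₀⟩ := exists_extPlan_planCost_ne_top hd h1.1 hm hf
    rw [hmin]
    exact ((iInf₂_le γ₀ hγ₀).trans_lt h₀.lt_top).ne
  -- the plan moves mass over a long distance in the neighbourhood `N` of `p`
  let N : Set (Rd d × Rd d) := {z | dist z.1 p.1 < 1 ∧ R < dist z.1 z.2}
  have hN : IsOpen N := by
    refine IsOpen.and ?_ ?_
    · exact isOpen_lt (by fun_prop) continuous_const
    · exact isOpen_lt continuous_const (by fun_prop)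
  have hNpos : 0 < γ N := hp N hN ⟨by simp, hpR⟩
  have hNm := hN.measurableSet
  -- the cell `B` of `p.1` has enough room to receive this mass
  let B : Set (Rd d) := q ⁻¹' {q p.1}
  have hB : MeasurableSet B := hq (measurableSet_singleton _)
  let ν : Measure (Rd d) := (fMeas (fun x => 1 - f x) - γ.map Prod.snd).restrict B
  set b := ν univ with hb
  have hbB : b = fMeas (fun x => 1 - f x) B - γ.map Prod.snd B := by
    rw [hb, Measure.restrict_apply_univ, Measure.sub_apply hB hγ.2]
  have hb_ge : ENNReal.ofReal m ≤ b := by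
    have hroom : ENNReal.ofReal m + ENNReal.ofReal m ≤ fMeas (fun x => 1 - f x) B := by
      refine le_fMeas_one_sub hf (le_trans ?_ (hvol _))
      rw [← ENNReal.ofReal_add hm.le hm.le, ← ENNReal.ofReal_add (by positivity) hm.le]
      exact ENNReal.ofReal_le_ofReal (le_max_right _ _)
    rw [hbB]
    refine ENNReal.le_sub_of_add_le_right (measure_ne_top _ _) (le_trans ?_ hroom)
    gcongr
    rw [Measure.map_apply measurable_snd hB]
    exact (measure_mono (subset_univ _)).trans hγm
  have hb0 : b ≠ 0 := ((ENNReal.ofReal_pos.2 hm).trans_le hb_ge).ne'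
  have hbt : b ≠ ∞ := by
    rw [hbB]
    exact (tsub_le_self.trans_lt ((fMeas_one_sub_le hf.1 _).trans_lt (hvfin _).lt_top)).ne
  have hνfin : IsFiniteMeasure ν := ⟨hbt.lt_top⟩
  let α : Measure (Rd d) := (γ.restrict N).map Prod.fst
  have hα : α univ = γ N := by
    rw [Measure.map_apply measurable_fst MeasurableSet.univ, preimage_univ,
      Measure.restrict_apply_univ]
  let γ' : Measure (Rd d × Rd d) := γ.restrict Nᶜ + b⁻¹ • α.prod ν
  have hγ' : γ' ∈ ExtPlans f := by
    constructor
    · rw [Measure.map_add _ _ measurable_fst, Measure.map_smul, Measure.map_fst_prod, ← hb,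
        smul_smul, ENNReal.inv_mul_cancel hb0 hbt, one_smul, ← Measure.map_add _ _ measurable_fst,
        Measure.restrict_compl_add_restrict hNm, hγ.1]
    · rw [Measure.map_add _ _ measurable_snd, Measure.map_smul, Measure.map_snd_prod, hα,
        smul_smul, ← Measure.sub_add_cancel_of_le hγ.2, add_comm]
      refine add_le_add (Measure.le_iff.2 fun s _ => ?_)
        (Measure.map_mono Measure.restrict_le_self measurable_snd)
      rw [Measure.smul_apply, smul_eq_mul]
      refine (mul_le_of_le_one_left zero_le ?_).trans (Measure.restrict_apply_le _ _)
      calc b⁻¹ * γ N ≤ b⁻¹ * b :=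
            mul_le_mul' le_rfl (((measure_mono (subset_univ _)).trans hγm).trans hb_ge)
        _ ≤ 1 := ENNReal.inv_mul_le_one _
  have hcost' : planCost (transCost k) γ' ≤
      ∫⁻ z in Nᶜ, ENNReal.ofReal (transCost k z.1 z.2) ∂γ + ENNReal.ofReal S * γ N := by
    rw [planCost, lintegral_add_measure, lintegral_smul_measure, lintegral_prod _ hcm.aemeasurable]
    gcongr
    have hαN : ∀ᵐ x ∂α, dist x p.1 < 1 := by
      rw [ae_map_iff measurable_fst.aemeasurable
        (measurableSet_lt (by fun_prop) measurable_const)]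
      filter_upwards [ae_restrict_mem hNm] with z hz using hz.1
    calc b⁻¹ * ∫⁻ x, ∫⁻ y, ENNReal.ofReal (transCost k x y) ∂ν ∂α
        ≤ b⁻¹ * ∫⁻ _, ∫⁻ _, ENNReal.ofReal S ∂ν ∂α := by
          refine mul_le_mul' le_rfl (lintegral_mono_ae ?_)
          filter_upwards [hαN] with x hx
          refine lintegral_mono_ae ?_
          filter_upwards [ae_restrict_mem hB] with y hy
          refine ENNReal.ofReal_le_ofReal (hS _ ?_)
          have h2 := hr p.1 y (Eq.symm hy)
          rw [dist_eq_norm, norm_sub_rev] at hx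
          calc ‖y - x‖ = ‖(y - p.1) + (p.1 - x)‖ := by abel_nf
            _ ≤ r + 1 := (norm_add_le _ _).trans (add_le_add h2 hx.le)
      _ = (b⁻¹ * b) * (ENNReal.ofReal S * γ N) := by
          rw [lintegral_const, lintegral_const, hα]
          ring
      _ = ENNReal.ofReal S * γ N := by rw [ENNReal.inv_mul_cancel hb0 hbt, one_mul]
  have hcost : ENNReal.ofReal (S + 1) * γ N +
      ∫⁻ z in Nᶜ, ENNReal.ofReal (transCost k z.1 z.2) ∂γ ≤ planCost (transCost k) γ := by
    rw [planCost, ← lintegral_add_compl (μ := γ) _ hNm]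
    refine add_le_add ?_ le_rfl
    rw [← setLIntegral_const]
    refine setLIntegral_mono' hNm fun z hz => ENNReal.ofReal_le_ofReal ?_
    by_contra! hlt
    have := hR _ hlt.le
    rw [← dist_eq_norm, dist_comm] at this
    exact this.not_gt hz.2
  have hIfin : ∫⁻ z in Nᶜ, ENNReal.ofReal (transCost k z.1 z.2) ∂γ ≠ ∞ :=
    ((setLIntegral_le_lintegral _ _).trans_lt hfin.lt_top).ne
  have hle := (hcost.trans (hmin.trans_le (iInf₂_le γ' hγ'))).trans hcost'
  rw [add_comm, ENNReal.add_le_add_iff_left hIfin,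
    ENNReal.mul_le_mul_iff_left hNpos.ne' (measure_ne_top _ _),
    ENNReal.ofReal_le_ofReal_iff hS0] at hle
  linarith

/-- under (H1), for every `m > 0` and `f ∈ L¹_m` the infimum defining `Υ(f)` is
attained; any minimiser `γ` satisfies `Υ(f) = 𝒯_c(f·Leb, γ_y)`; and there is a non-decreasing
`R(m)` such that `Υ(f)` equals the minimum of the cost over plans supported in
`{|x-y| ≤ R(m)}`, and every minimiser is supported there. -/
theorem stmt_8 {d : ℕ} (hd : 1 ≤ d) (k : Rd d → ℝ) (hpos : ∀ x, 0 ≤ k x) (h1 : H1 k) :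
    (∀ m : ℝ, 0 < m → ∀ f : Rd d → ℝ, MemL1m m f →
      (∃ γ ∈ ExtPlans f, planCost (transCost k) γ = Ups (transCost k) f) ∧
      (∀ γ ∈ ExtPlans f, planCost (transCost k) γ = Ups (transCost k) f →
        Ups (transCost k) f = Tcost (transCost k) (fMeas f) (γ.map Prod.snd))) ∧
    (∃ R : ℝ → ℝ, MonotoneOn R (Set.Ioi 0) ∧
      ∀ m : ℝ, 0 < m → ∀ f : Rd d → ℝ, MemL1m m f →
        (∃ γ ∈ ExtPlans f, (∀ p ∈ msupport γ, dist p.1 p.2 ≤ R m) ∧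
          planCost (transCost k) γ = Ups (transCost k) f) ∧
        (∀ γ ∈ ExtPlans f, planCost (transCost k) γ = Ups (transCost k) f →
          ∀ p ∈ msupport γ, dist p.1 p.2 ≤ R m)) := by
  have hmin : ∀ m : ℝ, 0 < m → ∀ f : Rd d → ℝ, MemL1m m f →
      ∃ γ ∈ ExtPlans f, planCost (transCost k) γ = Ups (transCost k) f := fun m hm f hf =>
    exists_planCost_eq_ups h1 hf.1 (exists_extPlan_planCost_ne_top hd h1.1 hm hf)
  refine ⟨fun m hm f hf => ⟨hmin m hm f hf, fun γ hγ hopt => le_antisymm ?_ ?_⟩, ?_⟩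
  · exact le_iInf₂ fun γ' hγ' => iInf₂_le γ' ⟨hγ'.1, hγ'.2.trans_le hγ.2⟩
  · exact (iInf₂_le γ ⟨hγ.1, rfl⟩).trans_eq hopt
  · choose R hR using fun n : ℕ => exists_dist_le_on_msupport hd h1 (m := n + 1) (by positivity)
    have hconf : ∀ m : ℝ, 0 < m → ∀ f : Rd d → ℝ, MemL1m m f → ∀ γ ∈ ExtPlans f,
        planCost (transCost k) γ = Ups (transCost k) f → ∀ p ∈ msupport γ,
        dist p.1 p.2 ≤ ∑ i ∈ Finset.range (⌈m⌉₊ + 1), |R i| := fun m hm f hf γ hγ hopt p hp =>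
      calc dist p.1 p.2 ≤ R ⌈m⌉₊ :=
            hR ⌈m⌉₊ f ⟨hf.1, hf.2.trans (by linarith [Nat.le_ceil m])⟩ γ hγ hopt p hp
        _ ≤ |R ⌈m⌉₊| := le_abs_self _
        _ ≤ _ := Finset.single_le_sum (f := fun i => |R i|) (fun i _ => abs_nonneg _)
            (Finset.self_mem_range_succ _)
    refine ⟨fun m => ∑ i ∈ Finset.range (⌈m⌉₊ + 1), |R i|, fun m _ m' _ hmm' => ?_,
      fun m hm f hf => ⟨?_, hconf m hm f hf⟩⟩
    · refine Finset.sum_le_sum_of_subset_of_nonneg ?_ fun _ _ _ => abs_nonneg _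
      exact Finset.range_mono (Nat.add_le_add_right (Nat.ceil_mono hmm') 1)
    · obtain ⟨γ, hγ, hopt⟩ := hmin m hm f hf
      exact ⟨γ, hγ, hconf m hm f hf γ hγ hopt, hopt⟩
end
end

section
/- Assume c(x,y) = k(y−x) with k satisfying (H1). Let m > 0 and f_1, f_2 ∈ L^1_m. If f_1 + f_2 ≤ 1 pointwise, then Υ(f_1 + f_2) ≥ Υ(f_1) + Υ(f_2). As a consequence, if f_1 ≤ f_2 pointwise then Υ(f_1) ≤ Υ(f_2). -/
open MeasureTheory ENNReal Filter Set

noncomputable section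

/-- The part of a plan for `f` that carries the share `g` of the mass at each starting point is a
plan for `h`, when `h = f * g` almost everywhere and `h ≤ f`. -/
theorem withDensity_fst_mem_extPlans {d : ℕ} {f h : Rd d → ℝ} {g : Rd d → ℝ≥0∞}
    {γ : Measure (Rd d × Rd d)} (hγ : γ ∈ ExtPlans f) (hf : AEMeasurable f volume)
    (hg : Measurable g) (hg1 : ∀ x, g x ≤ 1) (hhf : ∀ x, h x ≤ f x)
    (hfg : ∀ᵐ x, ENNReal.ofReal (f x) * g x = ENNReal.ofReal (h x)) :
    γ.withDensity (fun p => g p.1) ∈ ExtPlans h := by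
  refine ⟨?_, ?_⟩
  · have hmap : (γ.withDensity fun p => g p.1).map Prod.fst = (γ.map Prod.fst).withDensity g := by
      ext s hs
      rw [Measure.map_apply measurable_fst hs, withDensity_apply _ (measurable_fst hs),
        withDensity_apply _ hs, setLIntegral_map hs hg measurable_fst]
    rw [hmap, hγ.1, fMeas, fMeas, ← withDensity_mul₀ hf.ennreal_ofReal hg.aemeasurable]
    exact withDensity_congr_ae hfg
  · have hle : γ.withDensity (fun p => g p.1) ≤ γ := by
      conv_rhs => rw [← withDensity_one (μ := γ)]
      exact withDensity_mono (ae_of_all _ fun p => hg1 p.1)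
    refine (Measure.map_mono hle measurable_snd).trans (hγ.2.trans ?_)
    exact withDensity_mono (ae_of_all _ fun x => ENNReal.ofReal_le_ofReal (by linarith [hhf x]))

/-- Superadditivity of `Υ` for any measurable cost. -/
theorem ups_add_le {d : ℕ} {c : Rd d → Rd d → ℝ} (hc : Measurable fun p : Rd d × Rd d => c p.1 p.2)
    {f₁ f₂ : Rd d → ℝ} (hm₁ : AEMeasurable f₁ volume) (hm₂ : AEMeasurable f₂ volume)
    (h₁ : ∀ x, 0 ≤ f₁ x) (h₂ : ∀ x, 0 ≤ f₂ x) :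
    Ups c f₁ + Ups c f₂ ≤ Ups c (fun x => f₁ x + f₂ x) := by
  set a : Rd d → ℝ≥0∞ := fun x => ENNReal.ofReal (hm₁.mk f₁ x)
  set b : Rd d → ℝ≥0∞ := fun x => ENNReal.ofReal (hm₂.mk f₂ x)
  have hma : Measurable a := hm₁.measurable_mk.ennreal_ofReal
  have hmb : Measurable b := hm₂.measurable_mk.ennreal_ofReal
  have hma' : Measurable fun x => a x / (a x + b x) := hma.div (hma.add hmb)
  have hmb' : Measurable fun x => b x / (a x + b x) := hmb.div (hma.add hmb)
  have hsum : ∀ x, a x / (a x + b x) + b x / (a x + b x) ≤ 1 := fun x => by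
    rw [ENNReal.div_add_div_same]
    exact ENNReal.div_self_le_one
  refine le_iInf₂ fun γ hγ => ?_
  have hmem₁ : γ.withDensity (fun p => a p.1 / (a p.1 + b p.1)) ∈ ExtPlans f₁ := by
    refine withDensity_fst_mem_extPlans (g := fun x => a x / (a x + b x)) hγ
      (hm₁.fun_add hm₂) hma' (fun x => le_self_add.trans (hsum x)) (fun x => by linarith [h₂ x]) ?_
    filter_upwards [hm₁.ae_eq_mk, hm₂.ae_eq_mk] with x hx₁ hx₂
    rw [ENNReal.ofReal_add (h₁ x) (h₂ x), hx₁, hx₂]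
    exact ENNReal.mul_div_cancel' (fun h => (add_eq_zero.1 h).1) (fun h => by simp at h)
  have hmem₂ : γ.withDensity (fun p => b p.1 / (a p.1 + b p.1)) ∈ ExtPlans f₂ := by
    refine withDensity_fst_mem_extPlans (g := fun x => b x / (a x + b x)) hγ
      (hm₁.fun_add hm₂) hmb' (fun x => le_add_self.trans (hsum x)) (fun x => by linarith [h₁ x]) ?_
    filter_upwards [hm₁.ae_eq_mk, hm₂.ae_eq_mk] with x hx₁ hx₂
    rw [ENNReal.ofReal_add (h₁ x) (h₂ x), hx₁, hx₂]
    exact ENNReal.mul_div_cancel' (fun h => (add_eq_zero.1 h).2) (fun h => by simp at h)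
  refine (add_le_add (iInf₂_le _ hmem₁) (iInf₂_le _ hmem₂)).trans ?_
  have hma'' : Measurable fun p : Rd d × Rd d => a p.1 / (a p.1 + b p.1) :=
    hma'.comp measurable_fst
  have hmb'' : Measurable fun p : Rd d × Rd d => b p.1 / (a p.1 + b p.1) :=
    hmb'.comp measurable_fst
  have hc' := hc.ennreal_ofReal
  unfold planCost
  rw [lintegral_withDensity_eq_lintegral_mul _ hma'' hc',
    lintegral_withDensity_eq_lintegral_mul _ hmb'' hc', ← lintegral_add_left (hma''.mul hc')]
  refine lintegral_mono fun p => ?_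
  simp only [Pi.mul_apply, ← add_mul]
  exact mul_le_of_le_one_left' (hsum p.1)

/-- under (H1), `Υ` is superadditive on functions with `f₁ + f₂ ≤ 1`, and
monotone. -/
theorem stmt_9 {d : ℕ} (hd : 1 ≤ d) (k : Rd d → ℝ) (hpos : ∀ x, 0 ≤ k x) (h1 : H1 k)
    (m : ℝ) (hm : 0 < m) (f₁ f₂ : Rd d → ℝ) (hf₁ : MemL1m m f₁) (hf₂ : MemL1m m f₂) :
    ((∀ x, f₁ x + f₂ x ≤ 1) →
      Ups (transCost k) f₁ + Ups (transCost k) f₂ ≤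
        Ups (transCost k) (fun x => f₁ x + f₂ x)) ∧
    ((∀ x, f₁ x ≤ f₂ x) → Ups (transCost k) f₁ ≤ Ups (transCost k) f₂) := by
  have hc : Measurable fun p : Rd d × Rd d => transCost k p.1 p.2 :=
    (h1.1.comp (continuous_snd.sub continuous_fst)).measurable
  have hm₁ := hf₁.1.1.aemeasurable
  have hm₂ := hf₂.1.1.aemeasurable
  have h₁ := fun x => (hf₁.1.2 x).1
  refine ⟨fun _ => ups_add_le hc hm₁ hm₂ h₁ fun x => (hf₂.1.2 x).1, fun hle => ?_⟩
  have hsub := ups_add_le hc hm₁ (hm₂.sub hm₁) h₁ fun x => sub_nonneg.2 (hle x)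
  simp only [Pi.sub_apply, add_sub_cancel] at hsub
  exact le_self_add.trans hsub
end
end
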